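/- arXiv:1002.3010 — 5 statements merged into one kernel-verified Lean document; each statement's English description precedes it below -/
import Mathlib

section
/- The character space rep(F₂, SO(3)) is homeomorphic to the quotient space T/V of the solid tetrahedron T by the Klein four-group V of involutions. -/
noncomputable section

open Real

/-- The conjugation relation on pairs of elements of a group. -/
def ConjRel (G : Type) [Group G] (p q : G × G) : Prop :=
  ∃ g : G, q.1 = g * p.1 * g⁻¹ ∧ q.2 = g * p.2 * g⁻¹

/-- The `G`-character space of the free group of rank two: the quotient topological space of
`G × G` by the conjugation action `g • (a, b) = (g a g⁻¹, g b g⁻¹)`. -/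
abbrev RepF2 (G : Type) [Group G] [TopologicalSpace G] : Type :=
  Quotient (Relation.EqvGen.setoid (ConjRel G))

/-- `SO(3)`: the subgroup of the real orthogonal group of 3×3 matrices consisting of the
matrices of determinant `1`, i.e. the kernel of the determinant homomorphism. -/
def SO3Subgroup : Subgroup (Matrix.orthogonalGroup (Fin 3) ℝ) :=
  MonoidHom.ker (Matrix.detMonoidHom.comp (Submonoid.subtype _))

/-- The topological group `SO(3)` of real orthogonal 3×3 matrices of determinant one,
topologized as a subspace of the 3×3 real matrices. -/
abbrev SO3 : Type := ↥SO3Subgroup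

/-- The solid tetrahedron `T` with vertices `(π,0,0)`, `(0,π,0)`, `(0,0,π)`, `(π,π,π)`. -/
def Tet : Set (ℝ × ℝ × ℝ) :=
  {p | π ≤ p.1 + p.2.1 + p.2.2 ∧ p.2.1 + p.2.2 ≤ p.1 + π ∧
       p.1 + p.2.2 ≤ p.2.1 + π ∧ p.1 + p.2.1 ≤ p.2.2 + π}

/-- The involution `(x,y,z) ↦ (x, π−y, π−z)` of the tetrahedron. -/
def invA (p : ℝ × ℝ × ℝ) : ℝ × ℝ × ℝ := (p.1, π - p.2.1, π - p.2.2)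

/-- The involution `(x,y,z) ↦ (π−x, y, π−z)` of the tetrahedron. -/
def invB (p : ℝ × ℝ × ℝ) : ℝ × ℝ × ℝ := (π - p.1, p.2.1, π - p.2.2)

/-- The involution `(x,y,z) ↦ (π−x, π−y, z)` of the tetrahedron. -/
def invC (p : ℝ × ℝ × ℝ) : ℝ × ℝ × ℝ := (π - p.1, π - p.2.1, p.2.2)

/-- The relation on `T` generated by the three involutions of the Klein four-group `V`. -/
def TetRel (a b : ↥Tet) : Prop :=
  (b : ℝ × ℝ × ℝ) = invA a ∨ (b : ℝ × ℝ × ℝ) = invB a ∨ (b : ℝ × ℝ × ℝ) = invC a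

/-- The quotient `T/V` of the solid tetrahedron by the Klein four-group of involutions. -/
abbrev TetQuot : Type := Quotient (Relation.EqvGen.setoid TetRel)

open Quaternion Matrix Topology

/-- The quaternion with the given coordinates. -/
def quat (a b c d : ℝ) : ℍ[ℝ] := ⟨a, b, c, d⟩

@[simp] theorem quat_re (a b c d : ℝ) : (quat a b c d).re = a := rfl

@[simp] theorem quat_imI (a b c d : ℝ) : (quat a b c d).imI = b := rfl

@[simp] theorem quat_imJ (a b c d : ℝ) : (quat a b c d).imJ = c := rfl

@[simp] theorem quat_imK (a b c d : ℝ) : (quat a b c d).imK = d := rfl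

theorem exists_eq_quat (q : ℍ[ℝ]) : ∃ a b c d : ℝ, q = quat a b c d :=
  ⟨q.re, q.imI, q.imJ, q.imK, rfl⟩

/-- The sphere of unit quaternions. -/
abbrev UnitQuat : Type := Metric.sphere (0 : ℍ[ℝ]) 1

/-- The matrix of `v ↦ q v q̄` on imaginary quaternions. -/
def quatMatrix (q : ℍ[ℝ]) : Matrix (Fin 3) (Fin 3) ℝ :=
  !![q.re ^ 2 + q.imI ^ 2 - q.imJ ^ 2 - q.imK ^ 2, 2 * (q.imI * q.imJ - q.re * q.imK),
      2 * (q.imI * q.imK + q.re * q.imJ);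
    2 * (q.imI * q.imJ + q.re * q.imK), q.re ^ 2 - q.imI ^ 2 + q.imJ ^ 2 - q.imK ^ 2,
      2 * (q.imJ * q.imK - q.re * q.imI);
    2 * (q.imI * q.imK - q.re * q.imJ), 2 * (q.imJ * q.imK + q.re * q.imI),
      q.re ^ 2 - q.imI ^ 2 - q.imJ ^ 2 + q.imK ^ 2]

theorem quatMatrix_mul (a b : ℍ[ℝ]) : quatMatrix (a * b) = quatMatrix a * quatMatrix b := by
  ext i j
  fin_cases i <;> fin_cases j <;>
    simp [quatMatrix, Matrix.mul_apply, Fin.sum_univ_three] <;> ring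

theorem quatMatrix_one : quatMatrix 1 = 1 := by
  ext i j
  fin_cases i <;> fin_cases j <;> simp [quatMatrix]

theorem quatMatrix_neg (a : ℍ[ℝ]) : quatMatrix (-a) = quatMatrix a := by
  ext i j
  fin_cases i <;> fin_cases j <;> simp [quatMatrix]

theorem continuous_quatMatrix : Continuous quatMatrix := by
  have h0 := Quaternion.continuous_re
  have h1 := Quaternion.continuous_imI
  have h2 := Quaternion.continuous_imJ
  have h3 := Quaternion.continuous_imK
  refine continuous_matrix fun i j => ?_
  fin_cases i <;> fin_cases j <;> simp [quatMatrix] <;> fun_prop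

theorem norm_eq_one_iff_sum_sq (q : ℍ[ℝ]) :
    ‖q‖ = 1 ↔ q.re ^ 2 + q.imI ^ 2 + q.imJ ^ 2 + q.imK ^ 2 = 1 := by
  rw [← Quaternion.normSq_def', Quaternion.normSq_eq_norm_mul_self, ← sq,
    pow_eq_one_iff_of_nonneg (norm_nonneg q) two_ne_zero]

theorem UnitQuat.sum_sq (q : UnitQuat) :
    q.1.re ^ 2 + q.1.imI ^ 2 + q.1.imJ ^ 2 + q.1.imK ^ 2 = 1 :=
  (norm_eq_one_iff_sum_sq _).1 (by simp)

theorem quatMatrix_mul_transpose (q : ℍ[ℝ])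
    (h : q.re ^ 2 + q.imI ^ 2 + q.imJ ^ 2 + q.imK ^ 2 = 1) :
    quatMatrix q * (quatMatrix q)ᵀ = 1 := by
  have h2 : (q.re ^ 2 + q.imI ^ 2 + q.imJ ^ 2 + q.imK ^ 2) ^ 2 = 1 := by rw [h]; norm_num
  ext i j
  fin_cases i <;> fin_cases j <;>
    simp [quatMatrix, Matrix.mul_apply, Fin.sum_univ_three] <;>
    first | ring1 | linear_combination h2

theorem det_quatMatrix (q : ℍ[ℝ])
    (h : q.re ^ 2 + q.imI ^ 2 + q.imJ ^ 2 + q.imK ^ 2 = 1) : (quatMatrix q).det = 1 := by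
  have h3 : (q.re ^ 2 + q.imI ^ 2 + q.imJ ^ 2 + q.imK ^ 2) ^ 3 = 1 := by rw [h]; norm_num
  rw [Matrix.det_fin_three]
  simp [quatMatrix]
  linear_combination h3

/-- The double cover of `SO(3)` by the unit quaternions. -/
def quatToSO3 : UnitQuat →* SO3 where
  toFun q := ⟨⟨quatMatrix q.1, (Matrix.mem_orthogonalGroup_iff _ _).2
    (quatMatrix_mul_transpose _ q.sum_sq)⟩, det_quatMatrix _ q.sum_sq⟩
  map_one' := Subtype.ext (Subtype.ext quatMatrix_one)
  map_mul' _ _ := Subtype.ext (Subtype.ext (quatMatrix_mul _ _))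

theorem coe_quatToSO3 (q : UnitQuat) : ((quatToSO3 q).1.1) = quatMatrix q.1 := rfl

theorem continuous_quatToSO3 : Continuous quatToSO3 :=
  ((continuous_quatMatrix.comp continuous_subtype_val).subtype_mk _).subtype_mk _

theorem quatToSO3_neg (q : UnitQuat) : quatToSO3 (-q) = quatToSO3 q :=
  Subtype.ext (Subtype.ext (quatMatrix_neg _))

theorem quatToSO3_eq_iff (a b : UnitQuat) : quatToSO3 a = quatToSO3 b ↔ a = b ∨ a = -b := by
  constructor
  · intro h
    have hM : quatMatrix a.1 = quatMatrix b.1 := congrArg (fun R : SO3 => R.1.1) h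
    have ha := a.sum_sq
    have hb := b.sum_sq
    have e (i j) := congrFun (congrFun hM i) j
    have e00 := e 0 0
    have e01 := e 0 1
    have e02 := e 0 2
    have e10 := e 1 0
    have e11 := e 1 1
    have e12 := e 1 2
    have e20 := e 2 0
    have e21 := e 2 1
    have e22 := e 2 2
    clear e
    simp [quatMatrix] at e00 e01 e02 e10 e11 e12 e20 e21 e22
    obtain ⟨a, _⟩ := a
    obtain ⟨b, _⟩ := b
    obtain ⟨a0, a1, a2, a3, rfl⟩ := exists_eq_quat a
    obtain ⟨b0, b1, b2, b3, rfl⟩ := exists_eq_quat b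
    simp only [quat_re, quat_imI, quat_imJ, quat_imK] at *
    have p00 : a0 ^ 2 = b0 ^ 2 := by linarith
    have p01 : a0 * a1 = b0 * b1 := by linarith
    have p02 : a0 * a2 = b0 * b2 := by linarith
    have p03 : a0 * a3 = b0 * b3 := by linarith
    have p11 : a1 ^ 2 = b1 ^ 2 := by linarith
    have p12 : a1 * a2 = b1 * b2 := by linarith
    have p13 : a1 * a3 = b1 * b3 := by linarith
    have p22 : a2 ^ 2 = b2 ^ 2 := by linarith
    have p23 : a2 * a3 = b2 * b3 := by linarith
    have p33 : a3 ^ 2 = b3 ^ 2 := by linarith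
    set l := a0 * b0 + a1 * b1 + a2 * b2 + a3 * b3 with hl
    have q0 : a0 = l * b0 := by
      linear_combination (-a0) * ha + a0 * p00 + a1 * p01 + a2 * p02 + a3 * p03
    have q1 : a1 = l * b1 := by
      linear_combination (-a1) * ha + a0 * p01 + a1 * p11 + a2 * p12 + a3 * p13
    have q2 : a2 = l * b2 := by
      linear_combination (-a2) * ha + a0 * p02 + a1 * p12 + a2 * p22 + a3 * p23
    have q3 : a3 = l * b3 := by
      linear_combination (-a3) * ha + a0 * p03 + a1 * p13 + a2 * p23 + a3 * p33
    have hl2 : l ^ 2 = 1 := by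
      rw [q0, q1, q2, q3] at ha
      linear_combination ha - l ^ 2 * hb
    rcases eq_or_eq_neg_of_sq_eq_sq l 1 (by linarith) with h1 | h1
    · left
      rw [h1] at q0 q1 q2 q3
      exact Subtype.ext (Quaternion.ext _ _ (by simpa using q0) (by simpa using q1)
        (by simpa using q2) (by simpa using q3))
    · right
      rw [h1] at q0 q1 q2 q3
      exact Subtype.ext (Quaternion.ext _ _ (by simpa using q0) (by simpa using q1)
        (by simpa using q2) (by simpa using q3))
  · rintro (rfl | rfl)
    · rfl
    · exact quatToSO3_neg b

/-- A symmetric `4 × 4` matrix of rank one and trace `4` is `4` times the outer product of a unit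
vector with itself; the index with a positive diagonal entry is listed first. -/
theorem exists_outer_of_pos {m00 m01 m02 m03 m11 m12 m13 m22 m23 m33 : ℝ} (h0 : 0 < m00)
    (ht : m00 + m11 + m22 + m33 = 4)
    (h11 : m00 * m11 = m01 * m01) (h12 : m00 * m12 = m01 * m02) (h13 : m00 * m13 = m01 * m03)
    (h22 : m00 * m22 = m02 * m02) (h23 : m00 * m23 = m02 * m03) (h33 : m00 * m33 = m03 * m03) :
    ∃ a b c d : ℝ, a ^ 2 + b ^ 2 + c ^ 2 + d ^ 2 = 1 ∧
      4 * (a * a) = m00 ∧ 4 * (a * b) = m01 ∧ 4 * (a * c) = m02 ∧ 4 * (a * d) = m03 ∧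
      4 * (b * b) = m11 ∧ 4 * (b * c) = m12 ∧ 4 * (b * d) = m13 ∧
      4 * (c * c) = m22 ∧ 4 * (c * d) = m23 ∧ 4 * (d * d) = m33 := by
  obtain ⟨s, hs, rfl⟩ : ∃ s : ℝ, 0 < s ∧ m00 = 4 * (s * s) :=
    ⟨√(m00 / 4), by positivity, by rw [Real.mul_self_sqrt (by positivity)]; ring⟩
  have key {x y z : ℝ} (h : 4 * (s * s) * z = x * y) :
      4 * (x / (4 * s) * (y / (4 * s))) = z := by
    field_simp
    linear_combination -h
  have k11 := key h11
  have k22 := key h22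
  have k33 := key h33
  refine ⟨s, m01 / (4 * s), m02 / (4 * s), m03 / (4 * s), by linarith, rfl, ?_, ?_, ?_, k11,
    key h12, key h13, k22, key h23, k33⟩ <;> field_simp

theorem quatToSO3_surjective : Function.Surjective quatToSO3 := by
  intro R
  suffices h : ∃ q : ℍ[ℝ], q.re ^ 2 + q.imI ^ 2 + q.imJ ^ 2 + q.imK ^ 2 = 1 ∧
      quatMatrix q = R.1.1 by
    obtain ⟨q, hq, hR⟩ := h
    exact ⟨⟨q, by simpa using (norm_eq_one_iff_sum_sq q).2 hq⟩, Subtype.ext (Subtype.ext hR)⟩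
  obtain ⟨⟨M, hM⟩, hR⟩ := R
  have hdet : M.det = 1 := hR
  have h1 : M * Mᵀ = 1 := (Matrix.mem_orthogonalGroup_iff _ _).1 hM
  have h2 : Mᵀ * M = 1 := (Matrix.mem_orthogonalGroup_iff' _ _).1 hM
  have h3 : M.adjugate = Mᵀ := by
    have := Matrix.adjugate_mul M
    rw [hdet, one_smul] at this
    calc M.adjugate = M.adjugate * (M * Mᵀ) := by rw [h1, mul_one]
      _ = Mᵀ := by rw [← mul_assoc, this, one_mul]
  change ∃ q : ℍ[ℝ], _ ∧ quatMatrix q = M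
  clear hR hM
  rw [Matrix.adjugate_fin_three] at h3
  obtain ⟨a, b, c, d, e, f, g, h, k, rfl⟩ : ∃ a b c d e f g h k, M = !![a, b, c; d, e, f; g, h, k] :=
    ⟨_, _, _, _, _, _, _, _, _, Matrix.eta_fin_three M⟩
  have e1 (i j) := congrFun (congrFun h1 i) j
  have e2 (i j) := congrFun (congrFun h2 i) j
  have e3 (i j) := congrFun (congrFun h3 i) j
  simp [Matrix.mul_apply, Fin.sum_univ_three, Fin.forall_fin_succ] at e1 e2 e3
  clear h1 h2 h3 hdet
  obtain ⟨⟨r1, r2, r3⟩, ⟨_, r4, r5⟩, ⟨_, _, r6⟩⟩ := e1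
  obtain ⟨⟨c1, c2, c3⟩, ⟨_, c4, c5⟩, ⟨_, _, c6⟩⟩ := e2
  obtain ⟨⟨d1, d2, d3⟩, ⟨d4, d5, d6⟩, ⟨d7, d8, d9⟩⟩ := e3
  have finish (q0 q1 q2 q3 : ℝ) (hq : q0 ^ 2 + q1 ^ 2 + q2 ^ 2 + q3 ^ 2 = 1)
      (h00 : 4 * (q0 * q0) = 1 + a + e + k) (h01 : 4 * (q0 * q1) = h - f)
      (h02 : 4 * (q0 * q2) = c - g) (h03 : 4 * (q0 * q3) = d - b)
      (h11 : 4 * (q1 * q1) = 1 + a - e - k) (h12 : 4 * (q1 * q2) = b + d)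
      (h13 : 4 * (q1 * q3) = c + g) (h22 : 4 * (q2 * q2) = 1 - a + e - k)
      (h23 : 4 * (q2 * q3) = f + h) (h33 : 4 * (q3 * q3) = 1 - a - e + k) :
      ∃ q : ℍ[ℝ], q.re ^ 2 + q.imI ^ 2 + q.imJ ^ 2 + q.imK ^ 2 = 1 ∧
        quatMatrix q = !![a, b, c; d, e, f; g, h, k] := by
    refine ⟨quat q0 q1 q2 q3, hq, ?_⟩
    ext i j
    fin_cases i <;> fin_cases j <;> simp [quatMatrix] <;> linarith
  have hpos : 0 < 1 + a + e + k ∨ 0 < 1 + a - e - k ∨ 0 < 1 - a + e - k ∨ 0 < 1 - a - e + k := by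
    by_contra! hn
    linarith
  rcases hpos with hp | hp | hp | hp
  · obtain ⟨q0, q1, q2, q3, hq, h00, h01, h02, h03, h11, h12, h13, h22, h23, h33⟩ :=
      exists_outer_of_pos (m00 := 1 + a + e + k) (m01 := h - f) (m02 := c - g) (m03 := d - b)
        (m11 := 1 + a - e - k) (m12 := b + d) (m13 := c + g) (m22 := 1 - a + e - k)
        (m23 := f + h) (m33 := 1 - a - e + k) hp (by ring) (by linarith) (by linarith)
        (by linarith) (by linarith) (by linarith) (by linarith)
    exact finish q0 q1 q2 q3 (by linarith) h00 h01 h02 h03 h11 h12 h13 h22 h23 h33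
  · obtain ⟨q1, q0, q2, q3, hq, h11, h01, h12, h13, h00, h02, h03, h22, h23, h33⟩ :=
      exists_outer_of_pos (m00 := 1 + a - e - k) (m01 := h - f) (m02 := b + d) (m03 := c + g)
        (m11 := 1 + a + e + k) (m12 := c - g) (m13 := d - b) (m22 := 1 - a + e - k)
        (m23 := f + h) (m33 := 1 - a - e + k) hp (by ring) (by linarith) (by linarith)
        (by linarith) (by linarith) (by linarith) (by linarith)
    exact finish q0 q1 q2 q3 (by linarith) h00 (by linarith) h02 h03 h11 h12 h13 h22 h23 h33
  · obtain ⟨q2, q0, q1, q3, hq, h22, h02, h12, h23, h00, h01, h03, h11, h13, h33⟩ :=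
      exists_outer_of_pos (m00 := 1 - a + e - k) (m01 := c - g) (m02 := b + d) (m03 := f + h)
        (m11 := 1 + a + e + k) (m12 := h - f) (m13 := d - b) (m22 := 1 + a - e - k)
        (m23 := c + g) (m33 := 1 - a - e + k) hp (by ring) (by linarith) (by linarith)
        (by linarith) (by linarith) (by linarith) (by linarith)
    exact finish q0 q1 q2 q3 (by linarith) h00 h01 (by linarith) h03 h11 (by linarith) h13 h22 h23
      h33
  · obtain ⟨q3, q0, q1, q2, hq, h33, h03, h13, h23, h00, h01, h02, h11, h12, h22⟩ :=
      exists_outer_of_pos (m00 := 1 - a - e + k) (m01 := d - b) (m02 := c + g) (m03 := f + h)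
        (m11 := 1 + a + e + k) (m12 := h - f) (m13 := c - g) (m22 := 1 + a - e - k)
        (m23 := b + d) (m33 := 1 - a + e - k) hp (by ring) (by linarith) (by linarith)
        (by linarith) (by linarith) (by linarith) (by linarith)
    exact finish q0 q1 q2 q3 (by linarith) h00 h01 h02 (by linarith) h11 h12 (by linarith) h22
      (by linarith) h33

/-- Simultaneous conjugacy of pairs of quaternions. -/
def QuatConj (p q : ℍ[ℝ] × ℍ[ℝ]) : Prop :=
  ∃ h : ℍ[ℝ], h ≠ 0 ∧ h * p.1 = q.1 * h ∧ h * p.2 = q.2 * h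

theorem QuatConj.symm {p q : ℍ[ℝ] × ℍ[ℝ]} (H : QuatConj p q) : QuatConj q p := by
  obtain ⟨h, h0, h1, h2⟩ := H
  refine ⟨h⁻¹, inv_ne_zero h0, ?_, ?_⟩
  · rw [inv_mul_eq_iff_eq_mul₀ h0, ← mul_assoc, h1, mul_inv_cancel_right₀ h0]
  · rw [inv_mul_eq_iff_eq_mul₀ h0, ← mul_assoc, h2, mul_inv_cancel_right₀ h0]

theorem QuatConj.trans {p q r : ℍ[ℝ] × ℍ[ℝ]} (H : QuatConj p q) (K : QuatConj q r) :
    QuatConj p r := by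
  obtain ⟨h, h0, h1, h2⟩ := H
  obtain ⟨k, k0, k1, k2⟩ := K
  refine ⟨k * h, mul_ne_zero k0 h0, ?_, ?_⟩
  · rw [mul_assoc, h1, ← mul_assoc, k1, mul_assoc]
  · rw [mul_assoc, h2, ← mul_assoc, k2, mul_assoc]

theorem Quaternion.re_mul_swap (a b : ℍ[ℝ]) : (a * b).re = (b * a).re := by
  simp only [Quaternion.re_mul]
  ring

theorem re_eq_of_mul_eq_mul {h a c : ℍ[ℝ]} (h0 : h ≠ 0) (H : h * a = c * h) : c.re = a.re := by
  have : c = h * a * h⁻¹ := by rw [H, mul_inv_cancel_right₀ h0]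
  rw [this, Quaternion.re_mul_swap, inv_mul_cancel_left₀ h0]

theorem norm_eq_of_mul_eq_mul {h a c : ℍ[ℝ]} (h0 : h ≠ 0) (H : h * a = c * h) : ‖c‖ = ‖a‖ := by
  have := congrArg norm H
  rw [norm_mul, norm_mul, mul_comm] at this
  exact (mul_right_cancel₀ (norm_ne_zero_iff.2 h0) this).symm

theorem QuatConj.invariants {p q : ℍ[ℝ] × ℍ[ℝ]} (H : QuatConj p q) :
    q.1.re = p.1.re ∧ q.2.re = p.2.re ∧ (q.1 * q.2).re = (p.1 * p.2).re ∧
      ‖q.1‖ = ‖p.1‖ ∧ ‖q.2‖ = ‖p.2‖ := by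
  obtain ⟨h, h0, h1, h2⟩ := H
  refine ⟨re_eq_of_mul_eq_mul h0 h1, re_eq_of_mul_eq_mul h0 h2, re_eq_of_mul_eq_mul h0 ?_,
    norm_eq_of_mul_eq_mul h0 h1, norm_eq_of_mul_eq_mul h0 h2⟩
  rw [← mul_assoc, h1, mul_assoc, h2, mul_assoc]

/-- Every quaternion can be rotated so that its imaginary part is a nonnegative multiple of `i`. -/
theorem exists_rotate_to_i (a : ℍ[ℝ]) :
    ∃ h : ℍ[ℝ], h ≠ 0 ∧ ∃ s : ℝ, 0 ≤ s ∧ h * a = quat a.re s 0 0 * h := by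
  obtain ⟨a0, a1, a2, a3, rfl⟩ := exists_eq_quat a
  obtain ⟨n, hn, hn2⟩ : ∃ n : ℝ, 0 ≤ n ∧ n ^ 2 = a1 ^ 2 + a2 ^ 2 + a3 ^ 2 :=
    ⟨_, Real.sqrt_nonneg _, Real.sq_sqrt (by positivity)⟩
  by_cases h : n + a1 = 0
  · have h2 : a2 = 0 := by nlinarith [sq_nonneg a2, sq_nonneg a3]
    have h3 : a3 = 0 := by nlinarith [sq_nonneg a2, sq_nonneg a3]
    obtain rfl : a1 = -n := by linarith
    subst h2 h3
    refine ⟨quat 0 0 1 0, fun h => ?_, n, hn, ?_⟩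
    · simpa using congrArg QuaternionAlgebra.imJ h
    · ext <;> simp
  · refine ⟨quat 0 (n + a1) a2 a3, fun h' => h ?_, n, hn, ?_⟩
    · simpa using congrArg QuaternionAlgebra.imI h'
    · ext <;> simp <;>
        first | ring1 | linear_combination hn2

/-- Every quaternion can be rotated about the `i` axis into the half plane spanned by `i` and
nonnegative multiples of `j`. -/
theorem exists_rotate_about_i (b : ℍ[ℝ]) :
    ∃ h : ℍ[ℝ], h ≠ 0 ∧ (∀ x y : ℝ, h * quat x y 0 0 = quat x y 0 0 * h) ∧
      ∃ q : ℝ, 0 ≤ q ∧ h * b = quat b.re b.imI q 0 * h := by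
  obtain ⟨b0, b1, b2, b3, rfl⟩ := exists_eq_quat b
  obtain ⟨n, hn, hn2⟩ : ∃ n : ℝ, 0 ≤ n ∧ n ^ 2 = b2 ^ 2 + b3 ^ 2 :=
    ⟨_, Real.sqrt_nonneg _, Real.sq_sqrt (by positivity)⟩
  by_cases h : n + b2 = 0
  · have h3 : b3 = 0 := by nlinarith [sq_nonneg b3]
    obtain rfl : b2 = -n := by linarith
    subst h3
    refine ⟨quat 0 1 0 0, fun h => ?_, fun x y => ?_, n, hn, ?_⟩
    · simpa using congrArg QuaternionAlgebra.imI h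
    · ext <;> simp
    · ext <;> simp
  · refine ⟨quat (n + b2) (-b3) 0 0, fun h' => h ?_, fun x y => ?_, n, hn, ?_⟩
    · simpa using congrArg QuaternionAlgebra.re h'
    · ext <;> simp <;> ring
    · ext <;> simp <;>
        first | ring1 | linear_combination hn2 | linear_combination -hn2

theorem exists_conj_normal_form (a b : ℍ[ℝ]) :
    ∃ s p q : ℝ, 0 ≤ s ∧ 0 ≤ q ∧ (s = 0 → 0 ≤ p ∧ q = 0) ∧
      QuatConj (a, b) (quat a.re s 0 0, quat b.re p q 0) := by
  obtain ⟨h, h0, s, hs, H⟩ := exists_rotate_to_i a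
  by_cases hs0 : s = 0
  · subst hs0
    obtain ⟨k, k0, p, hp, K⟩ := exists_rotate_to_i b
    refine ⟨0, p, 0, le_rfl, le_rfl, fun _ => ⟨hp, rfl⟩, k, k0, ?_, K⟩
    have comm (x : ℍ[ℝ]) : quat a.re 0 0 0 * x = x * quat a.re 0 0 0 := by
      ext <;> simp <;> ring
    rw [comm] at H
    exact (congrArg (k * ·) (mul_left_cancel₀ h0 H)).trans (comm k).symm
  · obtain ⟨k, k0, kc, q, hq, K⟩ := exists_rotate_about_i (h * b * h⁻¹)
    have hre : (h * b * h⁻¹).re = b.re := by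
      rw [Quaternion.re_mul_swap, inv_mul_cancel_left₀ h0]
    refine ⟨s, (h * b * h⁻¹).imI, q, hs, hq, fun h => absurd h hs0, k * h, mul_ne_zero k0 h0, ?_, ?_⟩
    · change k * h * a = _ * (k * h)
      rw [mul_assoc, H, ← mul_assoc, kc, mul_assoc]
    · change k * h * b = _ * (k * h)
      rw [hre] at K
      rw [← mul_assoc, ← K]
      simp only [mul_assoc, inv_mul_cancel₀ h0, mul_one]

theorem sum_sq_eq_of_norm_eq {a b : ℍ[ℝ]} (h : ‖a‖ = ‖b‖) :
    a.re ^ 2 + a.imI ^ 2 + a.imJ ^ 2 + a.imK ^ 2 =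
      b.re ^ 2 + b.imI ^ 2 + b.imJ ^ 2 + b.imK ^ 2 := by
  rw [← Quaternion.normSq_def', ← Quaternion.normSq_def', Quaternion.normSq_eq_norm_mul_self,
    Quaternion.normSq_eq_norm_mul_self, h]

theorem quatConj_of_invariants {a b c d : ℍ[ℝ]} (ha : ‖a‖ = ‖c‖) (hb : ‖b‖ = ‖d‖)
    (h1 : a.re = c.re) (h2 : b.re = d.re) (h3 : (a * b).re = (c * d).re) :
    QuatConj (a, b) (c, d) := by
  obtain ⟨s, p, q, hs, hq, hsq, H⟩ := exists_conj_normal_form a b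
  obtain ⟨s', p', q', hs', hq', hsq', K⟩ := exists_conj_normal_form c d
  obtain ⟨-, -, H3, H4, H5⟩ := H.invariants
  obtain ⟨-, -, K3, K4, K5⟩ := K.invariants
  have e1 := sum_sq_eq_of_norm_eq (H4.trans (ha.trans K4.symm))
  have e2 := sum_sq_eq_of_norm_eq (H5.trans (hb.trans K5.symm))
  have e3 := H3.trans (h3.trans K3.symm)
  simp [h1, h2] at e1 e2 e3
  have es : s = s' := by rwa [pow_left_inj₀ hs hs' two_ne_zero] at e1
  subst es
  have hpq : p = p' ∧ q = q' := by
    by_cases h0 : s = 0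
    · obtain ⟨hp, rfl⟩ := hsq h0
      obtain ⟨hp', rfl⟩ := hsq' h0
      refine ⟨?_, rfl⟩
      exact (pow_left_inj₀ hp hp' two_ne_zero).1 (by linarith)
    · have hp : p = p' := mul_left_cancel₀ h0 (by linarith)
      subst hp
      exact ⟨rfl, (pow_left_inj₀ hq hq' two_ne_zero).1 (by linarith)⟩
  obtain ⟨rfl, rfl⟩ := hpq
  rw [h1, h2] at H
  exact H.trans K.symm

theorem exists_unit_conj {a b c d : UnitQuat}
    (h1 : a.1.re = c.1.re) (h2 : b.1.re = d.1.re) (h3 : (a.1 * b.1).re = (c.1 * d.1).re) :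
    ∃ h : UnitQuat, c = h * a * h⁻¹ ∧ d = h * b * h⁻¹ := by
  obtain ⟨h, h0, H1, H2⟩ := quatConj_of_invariants (a := a.1) (b := b.1) (c := c.1) (d := d.1)
    (by simp) (by simp) h1 h2 h3
  have hn : ‖h‖ ≠ 0 := norm_ne_zero_iff.2 h0
  refine ⟨⟨‖h‖⁻¹ • h, by simp [norm_smul, hn]⟩, ?_, ?_⟩
  · rw [eq_mul_inv_iff_mul_eq]
    exact Subtype.ext (by
      simpa using congrArg (‖h‖⁻¹ • ·) H1.symm)
  · rw [eq_mul_inv_iff_mul_eq]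
    exact Subtype.ext (by
      simpa using congrArg (‖h‖⁻¹ • ·) H2.symm)

theorem abs_re_le_one (q : UnitQuat) : -1 ≤ q.1.re ∧ q.1.re ≤ 1 :=
  abs_le.1 (abs_le_of_sq_le_sq (by
    have := q.sum_sq
    nlinarith [sq_nonneg q.1.imI, sq_nonneg q.1.imJ, sq_nonneg q.1.imK]) zero_le_one)

theorem abs_re_mul_sub_le (a b : UnitQuat) :
    |a.1.re * b.1.re - (a.1 * b.1).re| ≤ √(1 - a.1.re ^ 2) * √(1 - b.1.re ^ 2) := by
  have ha := a.sum_sq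
  have hb := b.sum_sq
  rw [← Real.sqrt_mul (by nlinarith [abs_re_le_one a])]
  apply Real.abs_le_sqrt
  rw [Quaternion.re_mul, show 1 - a.1.re ^ 2 = a.1.imI ^ 2 + a.1.imJ ^ 2 + a.1.imK ^ 2 by linarith,
    show 1 - b.1.re ^ 2 = b.1.imI ^ 2 + b.1.imJ ^ 2 + b.1.imK ^ 2 by linarith]
  nlinarith [sq_nonneg (a.1.imI * b.1.imJ - a.1.imJ * b.1.imI),
    sq_nonneg (a.1.imI * b.1.imK - a.1.imK * b.1.imI),
    sq_nonneg (a.1.imJ * b.1.imK - a.1.imK * b.1.imJ)]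

theorem mem_Tet_iff {x y z : ℝ} (hx : x ∈ Set.Icc 0 π) (hy : y ∈ Set.Icc 0 π)
    (hz : z ∈ Set.Icc 0 π) :
    (x, y, z) ∈ Tet ↔ |cos x * cos y + cos z| ≤ sin x * sin y := by
  obtain ⟨hx0, hx1⟩ := hx
  obtain ⟨hy0, hy1⟩ := hy
  obtain ⟨hz0, hz1⟩ := hz
  have h1 : cos z ≤ -cos (x + y) ↔ π ≤ x + y + z ∧ x + y ≤ z + π := by
    rw [← cos_pi_sub, ← cos_abs (π - (x + y)), strictAntiOn_cos.le_iff_ge ⟨hz0, hz1⟩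
      ⟨abs_nonneg _, abs_le.2 ⟨by linarith, by linarith⟩⟩, abs_le]
    constructor <;> rintro ⟨_, _⟩ <;> constructor <;> linarith
  have h2 : -cos (x - y) ≤ cos z ↔ y + z ≤ x + π ∧ x + z ≤ y + π := by
    rw [← cos_abs, ← cos_pi_sub, strictAntiOn_cos.le_iff_ge
      ⟨by linarith [abs_le.2 (⟨by linarith, by linarith⟩ : -π ≤ x - y ∧ x - y ≤ π)],
        by linarith [abs_nonneg (x - y)]⟩ ⟨hz0, hz1⟩, le_sub_comm, abs_le]
    constructor <;> rintro ⟨_, _⟩ <;> constructor <;> linarith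
  rw [cos_add] at h1
  rw [cos_sub] at h2
  have h3 : |cos x * cos y + cos z| ≤ sin x * sin y ↔
      cos z ≤ -(cos x * cos y - sin x * sin y) ∧ -(cos x * cos y + sin x * sin y) ≤ cos z := by
    rw [abs_le]
    constructor <;> rintro ⟨_, _⟩ <;> constructor <;> linarith
  rw [h3, h1, h2]
  simp only [Tet, Set.mem_ofPred_eq]
  tauto

theorem Tet_subset {x y z : ℝ} (h : (x, y, z) ∈ Tet) :
    x ∈ Set.Icc 0 π ∧ y ∈ Set.Icc 0 π ∧ z ∈ Set.Icc 0 π := by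
  obtain ⟨h1, h2, h3, h4⟩ := h
  simp only at h1 h2 h3 h4
  refine ⟨⟨?_, ?_⟩, ⟨?_, ?_⟩, ⟨?_, ?_⟩⟩ <;> linarith

/-- The angle coordinates of a pair of unit quaternions. -/
def angles (p : UnitQuat × UnitQuat) : ℝ × ℝ × ℝ :=
  (arccos p.1.1.re, arccos p.2.1.re, π - arccos (p.1 * p.2).1.re)

theorem cos_arccos_re (q : UnitQuat) : cos (arccos q.1.re) = q.1.re :=
  cos_arccos (abs_re_le_one q).1 (abs_re_le_one q).2

theorem angles_mem_Tet (p : UnitQuat × UnitQuat) : angles p ∈ Tet := by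
  refine (mem_Tet_iff ⟨arccos_nonneg _, arccos_le_pi _⟩ ⟨arccos_nonneg _, arccos_le_pi _⟩
    ⟨by linarith [arccos_le_pi (p.1 * p.2).1.re], by linarith [arccos_nonneg (p.1 * p.2).1.re]⟩).2 ?_
  rw [cos_pi_sub, cos_arccos_re, cos_arccos_re, cos_arccos_re, sin_arccos, sin_arccos,
    ← sub_eq_add_neg]
  exact abs_re_mul_sub_le _ _

/-- The map sending a pair of unit quaternions to its point of the tetrahedron. -/
def toTet (p : UnitQuat × UnitQuat) : Tet := ⟨angles p, angles_mem_Tet p⟩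

theorem continuous_toTet : Continuous toTet := by
  have h := Quaternion.continuous_re
  have h' : Continuous fun q : UnitQuat => q.1.re := h.comp continuous_subtype_val
  refine Continuous.subtype_mk ?_ _
  exact (continuous_arccos.comp (h'.comp continuous_fst)).prodMk
    ((continuous_arccos.comp (h'.comp continuous_snd)).prodMk
      (continuous_const.sub (continuous_arccos.comp (h'.comp continuous_mul))))

theorem toTet_surjective : Function.Surjective toTet := by
  rintro ⟨⟨x, y, z⟩, ht⟩
  obtain ⟨hx, hy, hz⟩ := Tet_subset ht
  have hc := (mem_Tet_iff hx hy hz).1 ht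
  have sx := sin_nonneg_of_mem_Icc hx
  have sy := sin_nonneg_of_mem_Icc hy
  obtain ⟨p, hp1, hp2⟩ : ∃ p : ℝ, p * sin x = cos x * cos y + cos z ∧ |p| ≤ sin y := by
    rcases sx.eq_or_lt with h0 | h0
    · rw [← h0, zero_mul] at hc
      exact ⟨0, by rw [abs_nonpos_iff.1 hc, zero_mul], by simpa using sy⟩
    · refine ⟨(cos x * cos y + cos z) / sin x, div_mul_cancel₀ _ h0.ne', ?_⟩
      rw [abs_div, abs_of_pos h0, div_le_iff₀ h0]
      linarith
  have hq : √(sin y ^ 2 - p ^ 2) ^ 2 = sin y ^ 2 - p ^ 2 :=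
    Real.sq_sqrt (sub_nonneg.2 (sq_le_sq.2 (by rwa [abs_of_nonneg sy])))
  let a : UnitQuat := ⟨quat (cos x) (sin x) 0 0, by
    simpa using (norm_eq_one_iff_sum_sq _).2 (by simp)⟩
  let b : UnitQuat := ⟨quat (cos y) p √(sin y ^ 2 - p ^ 2) 0, by
    simpa using (norm_eq_one_iff_sum_sq _).2 (by
      simp only [quat_re, quat_imI, quat_imJ, quat_imK, hq]
      linarith [sin_sq_add_cos_sq y])⟩
  have hab : (a * b).1.re = -cos z := by
    rw [Metric.unitSphere.coe_mul, Quaternion.re_mul]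
    simp only [a, b, quat_re, quat_imI, quat_imJ, quat_imK]
    linarith
  refine ⟨(a, b), Subtype.ext ?_⟩
  change (arccos (cos x), arccos (cos y), π - arccos (a * b).1.re) = (x, y, z)
  rw [hab, arccos_neg, arccos_cos hx.1 hx.2, arccos_cos hy.1 hy.2, arccos_cos hz.1 hz.2,
    sub_sub_cancel]

theorem arccos_re_neg (q : UnitQuat) : arccos (-q).1.re = π - arccos q.1.re := by
  rw [← arccos_neg]
  simp

theorem toTet_eq_iff (p q : UnitQuat × UnitQuat) :
    toTet p = toTet q ↔
      p.1.1.re = q.1.1.re ∧ p.2.1.re = q.2.1.re ∧ (p.1 * p.2).1.re = (q.1 * q.2).1.re := by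
  have inj (a b : UnitQuat) : arccos a.1.re = arccos b.1.re ↔ a.1.re = b.1.re :=
    arccos_injOn.eq_iff (abs_re_le_one a) (abs_re_le_one b)
  simp only [toTet, angles, Subtype.mk.injEq, Prod.mk.injEq, sub_right_inj, inj]

theorem toTet_neg_snd (a b : UnitQuat) : (toTet (a, -b) : ℝ × ℝ × ℝ) = invA (toTet (a, b)) := by
  have h : a * -b = -(a * b) := Subtype.ext (mul_neg a.1 b.1)
  simp only [toTet, angles, invA, h, arccos_re_neg]

theorem toTet_neg_fst (a b : UnitQuat) : (toTet (-a, b) : ℝ × ℝ × ℝ) = invB (toTet (a, b)) := by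
  have h : -a * b = -(a * b) := Subtype.ext (neg_mul a.1 b.1)
  simp only [toTet, angles, invB, h, arccos_re_neg]

theorem toTet_neg_neg (a b : UnitQuat) : (toTet (-a, -b) : ℝ × ℝ × ℝ) = invC (toTet (a, b)) := by
  have h : -a * -b = a * b := Subtype.ext (neg_mul_neg a.1 b.1)
  simp only [toTet, angles, invC, h, arccos_re_neg]

theorem toTet_conj (h a b : UnitQuat) : toTet (h * a * h⁻¹, h * b * h⁻¹) = toTet (a, b) := by
  have key (x : UnitQuat) : (h * x * h⁻¹).1.re = x.1.re := by
    rw [Metric.unitSphere.coe_mul, Quaternion.re_mul_swap, ← Metric.unitSphere.coe_mul,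
      ← mul_assoc, inv_mul_cancel, one_mul]
  exact (toTet_eq_iff _ _).2 ⟨key a, key b,
    (congrArg (fun q : UnitQuat => q.1.re) conj_mul).trans (key (a * b))⟩

/-- The class in the character space of the pair of rotations covered by a pair of unit
quaternions. -/
def toRepF2 (p : UnitQuat × UnitQuat) : RepF2 SO3 :=
  Quotient.mk _ (quatToSO3 p.1, quatToSO3 p.2)

/-- The class in `T/V` of a pair of unit quaternions. -/
def toTetQuot (p : UnitQuat × UnitQuat) : TetQuot :=
  Quotient.mk _ (toTet p)

theorem isQuotientMap_toRepF2 : IsQuotientMap toRepF2 := by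
  have hs : Function.Surjective (Prod.map quatToSO3 quatToSO3) :=
    quatToSO3_surjective.prodMap quatToSO3_surjective
  exact isQuotientMap_quotient_mk'.comp (IsQuotientMap.of_surjective_continuous hs
    (continuous_quatToSO3.prodMap continuous_quatToSO3))

theorem isQuotientMap_toTetQuot : IsQuotientMap toTetQuot :=
  isQuotientMap_quotient_mk'.comp
    (IsQuotientMap.of_surjective_continuous toTet_surjective continuous_toTet)

theorem toTetQuot_conj (h a b : UnitQuat) :
    toTetQuot (h * a * h⁻¹, h * b * h⁻¹) = toTetQuot (a, b) :=
  congrArg (Quotient.mk _) (toTet_conj h a b)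

theorem toTetQuot_eq_of_tetRel {p q : UnitQuat × UnitQuat} (h : TetRel (toTet q) (toTet p)) :
    toTetQuot p = toTetQuot q :=
  (Quotient.sound (Relation.EqvGen.rel _ _ h)).symm

theorem toTetQuot_eq_of_conjRel {p q : UnitQuat × UnitQuat}
    (H : ConjRel SO3 (quatToSO3 p.1, quatToSO3 p.2) (quatToSO3 q.1, quatToSO3 q.2)) :
    toTetQuot q = toTetQuot p := by
  obtain ⟨a, b⟩ := p
  obtain ⟨c, d⟩ := q
  obtain ⟨g, h1, h2⟩ := H
  obtain ⟨h, rfl⟩ := quatToSO3_surjective g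
  simp only [← map_mul, ← map_inv, quatToSO3_eq_iff] at h1 h2
  rw [← toTetQuot_conj h a b]
  rcases h1 with rfl | rfl <;> rcases h2 with rfl | rfl
  · rfl
  · exact toTetQuot_eq_of_tetRel (Or.inl (toTet_neg_snd _ _))
  · exact toTetQuot_eq_of_tetRel (Or.inr (Or.inl (toTet_neg_fst _ _)))
  · exact toTetQuot_eq_of_tetRel (Or.inr (Or.inr (toTet_neg_neg _ _)))

theorem toRepF2_eq_of_toTet_eq {p q : UnitQuat × UnitQuat} (H : toTet p = toTet q) :
    toRepF2 p = toRepF2 q := by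
  obtain ⟨h1, h2, h3⟩ := (toTet_eq_iff p q).1 H
  obtain ⟨h, e1, e2⟩ := exists_unit_conj h1 h2 h3
  refine Quotient.sound (Relation.EqvGen.rel _ _ ⟨quatToSO3 h, ?_, ?_⟩)
  · simp only [e1, map_mul, map_inv]
  · simp only [e2, map_mul, map_inv]

theorem toRepF2_eq_of_tetRel {p q : UnitQuat × UnitQuat} (H : TetRel (toTet p) (toTet q)) :
    toRepF2 q = toRepF2 p := by
  obtain ⟨a, b⟩ := p
  rcases H with H | H | H
  · rw [← toTet_neg_snd] at H
    rw [toRepF2_eq_of_toTet_eq (Subtype.ext H)]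
    simp only [toRepF2, quatToSO3_neg]
  · rw [← toTet_neg_fst] at H
    rw [toRepF2_eq_of_toTet_eq (Subtype.ext H)]
    simp only [toRepF2, quatToSO3_neg]
  · rw [← toTet_neg_neg] at H
    rw [toRepF2_eq_of_toTet_eq (Subtype.ext H)]
    simp only [toRepF2, quatToSO3_neg]

theorem toTetQuot_eq_of_toRepF2_eq {p q : UnitQuat × UnitQuat} (H : toRepF2 p = toRepF2 q) :
    toTetQuot p = toTetQuot q := by
  have key (u v : SO3 × SO3) (huv : Relation.EqvGen (ConjRel SO3) u v) :
      ∀ p q : UnitQuat × UnitQuat, (quatToSO3 p.1, quatToSO3 p.2) = u →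
        (quatToSO3 q.1, quatToSO3 q.2) = v → toTetQuot p = toTetQuot q := by
    induction huv with
    | rel u v h =>
      rintro p q rfl rfl
      exact (toTetQuot_eq_of_conjRel h).symm
    | refl u =>
      rintro p q rfl hq
      refine toTetQuot_eq_of_conjRel ⟨1, ?_, ?_⟩
      · simpa using (Prod.ext_iff.1 hq).1.symm
      · simpa using (Prod.ext_iff.1 hq).2.symm
    | symm u v _ ih => exact fun p q hp hq => (ih q p hq hp).symm
    | trans u v w _ _ ih1 ih2 =>
      intro p q hp hq
      obtain ⟨a, ha⟩ := quatToSO3_surjective v.1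
      obtain ⟨b, hb⟩ := quatToSO3_surjective v.2
      have hv : (quatToSO3 (a, b).1, quatToSO3 (a, b).2) = v := Prod.ext ha hb
      exact (ih1 p (a, b) hp hv).trans (ih2 (a, b) q hv hq)
  exact key _ _ (Quotient.exact H) p q rfl rfl

theorem toRepF2_eq_of_toTetQuot_eq {p q : UnitQuat × UnitQuat} (H : toTetQuot p = toTetQuot q) :
    toRepF2 p = toRepF2 q := by
  have key (u v : Tet) (huv : Relation.EqvGen TetRel u v) :
      ∀ p q : UnitQuat × UnitQuat, toTet p = u → toTet q = v → toRepF2 p = toRepF2 q := by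
    induction huv with
    | rel u v h =>
      rintro p q rfl rfl
      exact (toRepF2_eq_of_tetRel h).symm
    | refl u => exact fun p q hp hq => toRepF2_eq_of_toTet_eq (hp.trans hq.symm)
    | symm u v _ ih => exact fun p q hp hq => (ih q p hq hp).symm
    | trans u v w _ _ ih1 ih2 =>
      intro p q hp hq
      obtain ⟨r, hr⟩ := toTet_surjective v
      exact (ih1 p r hp hr).trans (ih2 r q hr hq)
  exact key _ _ (Quotient.exact H) p q rfl rfl

/-- The character space `rep(F₂, SO(3))` is homeomorphic to the quotient
of the solid tetrahedron `T` by the Klein four-group `V`. -/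
theorem repF2_SO3_homeomorph_tet_quot : Nonempty (RepF2 SO3 ≃ₜ TetQuot) := by
  have hker : Setoid.ker toRepF2 = Setoid.ker toTetQuot :=
    Setoid.ext fun _ _ => ⟨toTetQuot_eq_of_toRepF2_eq, toRepF2_eq_of_toTetQuot_eq⟩
  let f : C(UnitQuat × UnitQuat, RepF2 SO3) := ⟨toRepF2, isQuotientMap_toRepF2.continuous⟩
  let g : C(UnitQuat × UnitQuat, TetQuot) := ⟨toTetQuot, isQuotientMap_toTetQuot.continuous⟩
  have hf : IsQuotientMap f := isQuotientMap_toRepF2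
  have hg : IsQuotientMap g := isQuotientMap_toTetQuot
  have e : Nonempty (Quotient (Setoid.ker f) ≃ₜ Quotient (Setoid.ker g)) := by
    change Nonempty (Quotient (Setoid.ker toRepF2) ≃ₜ Quotient (Setoid.ker toTetQuot))
    rw [hker]
    exact ⟨Homeomorph.refl _⟩
  exact e.map fun e => hf.homeomorph.symm.trans (e.trans hg.homeomorph)
end
end

section
/- The character space rep(F₂, SU(2)) (with SU(2) realized as the group S of unit quaternions) is homeomorphic to the solid tetrahedron T. -/
noncomputable section

open Real

open scoped Quaternion

/-- The group `S` of unit quaternions (isomorphic to `SU(2)`). -/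
abbrev SQ : Type := ↥(Metric.sphere (0 : ℍ[ℝ]) 1)

lemma abs_cos_mul_cos_add_cos_le_iff {x y z : ℝ} (hx : x ∈ Set.Icc 0 π) (hy : y ∈ Set.Icc 0 π)
    (hz : z ∈ Set.Icc 0 π) :
    |cos x * cos y + cos z| ≤ sin x * sin y ↔ (x, y, z) ∈ Tet := by
  obtain ⟨hx0, hx1⟩ := hx
  obtain ⟨hy0, hy1⟩ := hy
  obtain ⟨hz0, hz1⟩ := hz
  have hz' : cos (π - z) = -cos z := cos_pi_sub z
  have hdiff : -(sin x * sin y) ≤ cos x * cos y + cos z ↔ |x - y| ≤ π - z := by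
    have h := strictAntiOn_cos.le_iff_ge (a := π - z) (b := |x - y|)
      ⟨by linarith, by linarith⟩ ⟨abs_nonneg _, abs_le.2 ⟨by linarith, by linarith⟩⟩
    rw [← h, cos_abs, cos_sub x, hz']
    constructor <;> intro _ <;> linarith
  have hsum : cos x * cos y + cos z ≤ sin x * sin y ↔ π - z ≤ x + y ∧ x + y ≤ π + z := by
    have h : cos x * cos y + cos z ≤ sin x * sin y ↔ cos (x + y) ≤ cos (π - z) := by
      rw [cos_add, hz']
      constructor <;> intro _ <;> linarith
    rw [h]
    rcases le_total (x + y) π with hxy | hxy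
    · rw [strictAntiOn_cos.le_iff_ge (a := x + y) (b := π - z)
        ⟨by linarith, by linarith⟩ ⟨by linarith, by linarith⟩]
      exact ⟨fun h => ⟨h, by linarith⟩, fun h => h.1⟩
    · rw [← cos_two_pi_sub (x + y), strictAntiOn_cos.le_iff_ge (a := 2 * π - (x + y)) (b := π - z)
        ⟨by linarith, by linarith⟩ ⟨by linarith, by linarith⟩]
      exact ⟨fun h => ⟨by linarith, by linarith⟩, fun h => by linarith [h.2]⟩
  rw [abs_le, hdiff, hsum, abs_le]
  simp only [Tet, Set.mem_ofPred_eq]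
  constructor
  · rintro ⟨⟨_, _⟩, _, _⟩
    refine ⟨?_, ?_, ?_, ?_⟩ <;> linarith
  · rintro ⟨_, _, _, _⟩
    refine ⟨⟨?_, ?_⟩, ?_, ?_⟩ <;> linarith

/-- The real quaternion with the given coefficients of `1`, `i`, `j` and `k`. -/
def quatOfCoeffs (w x y z : ℝ) : ℍ[ℝ] := ⟨w, x, y, z⟩

section quatOfCoeffs

variable (w x y z : ℝ)

@[simp] lemma re_quatOfCoeffs : (quatOfCoeffs w x y z).re = w := rfl

@[simp] lemma imI_quatOfCoeffs : (quatOfCoeffs w x y z).imI = x := rfl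

@[simp] lemma imJ_quatOfCoeffs : (quatOfCoeffs w x y z).imJ = y := rfl

@[simp] lemma imK_quatOfCoeffs : (quatOfCoeffs w x y z).imK = z := rfl

end quatOfCoeffs

lemma Quaternion.re_mul_comm (p q : ℍ[ℝ]) : (p * q).re = (q * p).re := by
  simp only [Quaternion.re_mul]
  ring

lemma mem_unitSphere_iff (q : ℍ[ℝ]) :
    q ∈ Metric.sphere (0 : ℍ[ℝ]) 1 ↔ q.re ^ 2 + q.imI ^ 2 + q.imJ ^ 2 + q.imK ^ 2 = 1 := by
  rw [mem_sphere_zero_iff_norm, ← Quaternion.normSq_def', Quaternion.normSq_eq_norm_mul_self]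
  constructor
  · intro h
    rw [h, one_mul]
  · intro h
    nlinarith [norm_nonneg q]

lemma SQ.sq_sum (a : SQ) :
    (a : ℍ[ℝ]).re ^ 2 + (a : ℍ[ℝ]).imI ^ 2 + (a : ℍ[ℝ]).imJ ^ 2 + (a : ℍ[ℝ]).imK ^ 2 = 1 :=
  (mem_unitSphere_iff _).1 a.2

lemma SQ.abs_re_le (a : SQ) : |(a : ℍ[ℝ]).re| ≤ 1 := by
  have h := a.sq_sum
  rw [abs_le]
  constructor <;> nlinarith [sq_nonneg (a : ℍ[ℝ]).imI, sq_nonneg (a : ℍ[ℝ]).imJ,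
    sq_nonneg (a : ℍ[ℝ]).imK]

lemma SQ.re_conj (g a : SQ) : ((g * a * g⁻¹ : SQ) : ℍ[ℝ]).re = (a : ℍ[ℝ]).re := by
  have h : ((g⁻¹ * (g * a) : SQ) : ℍ[ℝ]).re = (a : ℍ[ℝ]).re := by
    rw [inv_mul_cancel_left]
  rw [← h, Metric.unitSphere.coe_mul, Metric.unitSphere.coe_mul _ (g * a),
    Quaternion.re_mul_comm]

/-- The triple of angles of `a`, `b` and `a * b`, each subtracted from `π`. -/
def pairAngles (p : SQ × SQ) : ℝ × ℝ × ℝ :=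
  (arccos (-(p.1 : ℍ[ℝ]).re), arccos (-(p.2 : ℍ[ℝ]).re),
    arccos (-((p.1 * p.2 : SQ) : ℍ[ℝ]).re))

lemma continuous_pairAngles : Continuous pairAngles := by
  have hre (f : SQ × SQ → SQ) (hf : Continuous f) :
      Continuous fun p => arccos (-(f p : ℍ[ℝ]).re) :=
    continuous_arccos.comp (Quaternion.continuous_re.comp (continuous_subtype_val.comp hf)).neg
  exact (hre _ continuous_fst).prodMk
    ((hre _ continuous_snd).prodMk (hre _ (continuous_fst.mul continuous_snd)))

lemma cos_arccos_neg_re (a : SQ) : cos (arccos (-(a : ℍ[ℝ]).re)) = -(a : ℍ[ℝ]).re := by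
  have h := abs_le.1 a.abs_re_le
  exact cos_arccos (by linarith) (by linarith)

lemma arccos_neg_re_inj {a b : SQ} :
    arccos (-(a : ℍ[ℝ]).re) = arccos (-(b : ℍ[ℝ]).re) ↔ (a : ℍ[ℝ]).re = (b : ℍ[ℝ]).re := by
  constructor
  · intro h
    have h' := congrArg cos h
    rw [cos_arccos_neg_re, cos_arccos_neg_re] at h'
    exact neg_injective h'
  · intro h
    rw [h]

lemma pairAngles_eq_iff (p q : SQ × SQ) :
    pairAngles p = pairAngles q ↔
      (p.1 : ℍ[ℝ]).re = (q.1 : ℍ[ℝ]).re ∧ (p.2 : ℍ[ℝ]).re = (q.2 : ℍ[ℝ]).re ∧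
        ((p.1 * p.2 : SQ) : ℍ[ℝ]).re = ((q.1 * q.2 : SQ) : ℍ[ℝ]).re := by
  simp only [pairAngles, Prod.mk.injEq, arccos_neg_re_inj]

lemma pairAngles_mem_Tet (p : SQ × SQ) : pairAngles p ∈ Tet := by
  obtain ⟨a, b⟩ := p
  refine (abs_cos_mul_cos_add_cos_le_iff ⟨arccos_nonneg _, arccos_le_pi _⟩
    ⟨arccos_nonneg _, arccos_le_pi _⟩ ⟨arccos_nonneg _, arccos_le_pi _⟩).1 ?_
  rw [cos_arccos_neg_re, cos_arccos_neg_re, cos_arccos_neg_re, sin_arccos, sin_arccos,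
    ← sqrt_mul' _ (by nlinarith [abs_le.1 b.abs_re_le])]
  apply abs_le_sqrt
  have ha := a.sq_sum
  have hb := b.sq_sum
  rw [Metric.unitSphere.coe_mul, Quaternion.re_mul]
  generalize (a : ℍ[ℝ]) = a at *
  generalize (b : ℍ[ℝ]) = b at *
  have ha' : 1 - (-a.re) ^ 2 = a.imI ^ 2 + a.imJ ^ 2 + a.imK ^ 2 := by linarith
  have hb' : 1 - (-b.re) ^ 2 = b.imI ^ 2 + b.imJ ^ 2 + b.imK ^ 2 := by linarith
  rw [ha', hb']
  nlinarith [sq_nonneg (a.imI * b.imJ - a.imJ * b.imI), sq_nonneg (a.imI * b.imK - a.imK * b.imI),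
    sq_nonneg (a.imJ * b.imK - a.imK * b.imJ)]

lemma pairAngles_eq_of_conjRel {p q : SQ × SQ} (h : ConjRel SQ p q) :
    pairAngles p = pairAngles q := by
  obtain ⟨g, h1, h2⟩ := h
  have h12 : q.1 * q.2 = g * (p.1 * p.2) * g⁻¹ := by
    rw [h1, h2]
    group
  rw [pairAngles_eq_iff, h12, h1, h2]
  simp only [SQ.re_conj, and_self]

lemma pairAngles_eq_of_eqvGen {p q : SQ × SQ} (h : Relation.EqvGen (ConjRel SQ) p q) :
    pairAngles p = pairAngles q := by
  induction h with
  | rel _ _ h => exact pairAngles_eq_of_conjRel h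
  | refl _ => rfl
  | symm _ _ _ ih => exact ih.symm
  | trans _ _ _ _ _ ih₁ ih₂ => exact ih₁.trans ih₂

lemma exists_mul_eq_mul_of_abs_le {s t r : ℝ} (hs : 0 ≤ s) (ht : 0 ≤ t) (h : |r| ≤ s * t) :
    ∃ v, s * v = r ∧ v ^ 2 ≤ t ^ 2 := by
  rcases hs.eq_or_lt with rfl | hs
  · refine ⟨0, ?_, by nlinarith⟩
    rw [zero_mul] at h
    rw [abs_nonpos_iff.1 h, mul_zero]
  · refine ⟨r / s, mul_div_cancel₀ r hs.ne', ?_⟩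
    rw [sq_le_sq, abs_of_nonneg ht, abs_div, abs_of_pos hs, div_le_iff₀ hs]
    linarith

lemma exists_pairAngles_eq {t : ℝ × ℝ × ℝ} (ht : t ∈ Tet) : ∃ p, pairAngles p = t := by
  obtain ⟨x, y, z⟩ := t
  obtain ⟨h1, h2, h3, h4⟩ := id ht
  dsimp only at h1 h2 h3 h4
  have hx : x ∈ Set.Icc 0 π := ⟨by linarith, by linarith⟩
  have hy : y ∈ Set.Icc 0 π := ⟨by linarith, by linarith⟩
  have hz : z ∈ Set.Icc 0 π := ⟨by linarith, by linarith⟩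
  obtain ⟨v, hv, hvy⟩ := exists_mul_eq_mul_of_abs_le (sin_nonneg_of_mem_Icc hx)
    (sin_nonneg_of_mem_Icc hy) ((abs_cos_mul_cos_add_cos_le_iff hx hy hz).2 ht)
  let a : SQ := ⟨quatOfCoeffs (-cos x) (sin x) 0 0, by
    rw [mem_unitSphere_iff]
    simp only [re_quatOfCoeffs, imI_quatOfCoeffs, imJ_quatOfCoeffs, imK_quatOfCoeffs]
    linarith [sin_sq_add_cos_sq x]⟩
  let b : SQ := ⟨quatOfCoeffs (-cos y) v √(sin y ^ 2 - v ^ 2) 0, by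
    rw [mem_unitSphere_iff]
    simp only [re_quatOfCoeffs, imI_quatOfCoeffs, imJ_quatOfCoeffs, imK_quatOfCoeffs]
    rw [sq_sqrt (by linarith)]
    linarith [sin_sq_add_cos_sq y]⟩
  have hab : ((a * b : SQ) : ℍ[ℝ]).re = -cos z := by
    rw [Metric.unitSphere.coe_mul, Quaternion.re_mul]
    simp only [a, b, re_quatOfCoeffs, imI_quatOfCoeffs, imJ_quatOfCoeffs, imK_quatOfCoeffs]
    linarith
  refine ⟨(a, b), ?_⟩
  simp only [pairAngles, hab, a, b, re_quatOfCoeffs, neg_neg]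
  rw [arccos_cos hx.1 hx.2, arccos_cos hy.1 hy.2, arccos_cos hz.1 hz.2]

lemma exists_unit_conj_eq {g : ℍ[ℝ]} (hg : g ≠ 0) :
    ∃ u : SQ, ∀ (a : SQ) (c : ℍ[ℝ]), g * a = c * g → ((u * a * u⁻¹ : SQ) : ℍ[ℝ]) = c := by
  refine ⟨⟨‖g‖⁻¹ • g, ?_⟩, fun a c h => ?_⟩
  · rw [mem_sphere_zero_iff_norm, norm_smul, norm_inv, norm_norm,
      inv_mul_cancel₀ (norm_ne_zero_iff.2 hg)]
  · have hn : ‖g‖⁻¹ • g ≠ 0 := smul_ne_zero (inv_ne_zero (norm_ne_zero_iff.2 hg)) hg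
    rw [Metric.unitSphere.coe_mul, Metric.unitSphere.coe_mul, Metric.unitSphere.coe_inv,
      mul_inv_eq_iff_eq_mul₀ hn, smul_mul_assoc, h, mul_smul_comm]

lemma exists_conj_complex (a : SQ) :
    ∃ u : SQ, ∃ r : ℝ, 0 ≤ r ∧
      ((u * a * u⁻¹ : SQ) : ℍ[ℝ]) = quatOfCoeffs (a : ℍ[ℝ]).re r 0 0 := by
  set q := (a : ℍ[ℝ])
  set r := √(q.imI ^ 2 + q.imJ ^ 2 + q.imK ^ 2)
  have hr2 : r ^ 2 = q.imI ^ 2 + q.imJ ^ 2 + q.imK ^ 2 := sq_sqrt (by positivity)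
  suffices h : ∃ g : ℍ[ℝ], g ≠ 0 ∧ g * q = quatOfCoeffs q.re r 0 0 * g by
    obtain ⟨g, hg, h⟩ := h
    obtain ⟨u, hu⟩ := exists_unit_conj_eq hg
    exact ⟨u, r, sqrt_nonneg _, hu _ _ h⟩
  by_cases h0 : quatOfCoeffs 0 (r + q.imI) q.imJ q.imK = 0
  · obtain ⟨-, h1, h2, h3⟩ := Quaternion.ext_iff.1 h0
    simp only [imI_quatOfCoeffs, imJ_quatOfCoeffs, imK_quatOfCoeffs, Quaternion.imI_zero,
      Quaternion.imJ_zero, Quaternion.imK_zero] at h1 h2 h3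
    refine ⟨quatOfCoeffs 0 0 1 0,
      fun h => one_ne_zero (congrArg (fun q : ℍ[ℝ] => q.imJ) h), ?_⟩
    ext <;> simp [h2, h3]
    linarith
  · refine ⟨_, h0, ?_⟩
    ext <;> simp <;> nlinarith

lemma exists_conj_snd {a b : SQ} (hJ : (a : ℍ[ℝ]).imJ = 0) (hK : (a : ℍ[ℝ]).imK = 0) :
    ∃ u : SQ, u * a * u⁻¹ = a ∧ ((u * b * u⁻¹ : SQ) : ℍ[ℝ]).imK = 0 ∧
      0 ≤ ((u * b * u⁻¹ : SQ) : ℍ[ℝ]).imJ := by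
  set p := (a : ℍ[ℝ])
  set q := (b : ℍ[ℝ])
  set s := √(q.imJ ^ 2 + q.imK ^ 2)
  have hs2 : s ^ 2 = q.imJ ^ 2 + q.imK ^ 2 := sq_sqrt (by positivity)
  suffices h : ∃ g : ℍ[ℝ], g ≠ 0 ∧ g * p = p * g ∧
      g * q = quatOfCoeffs q.re q.imI s 0 * g by
    obtain ⟨g, hg, h1, h2⟩ := h
    obtain ⟨u, hu⟩ := exists_unit_conj_eq hg
    refine ⟨u, Subtype.ext (hu _ _ h1), ?_, ?_⟩
    · rw [hu _ _ h2, imK_quatOfCoeffs]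
    · rw [hu _ _ h2, imJ_quatOfCoeffs]
      exact sqrt_nonneg _
  by_cases h0 : quatOfCoeffs (q.imJ + s) (-q.imK) 0 0 = 0
  · obtain ⟨h2, h3, -, -⟩ := Quaternion.ext_iff.1 h0
    simp only [re_quatOfCoeffs, imI_quatOfCoeffs, Quaternion.re_zero, Quaternion.imI_zero,
      neg_eq_zero] at h2 h3
    refine ⟨quatOfCoeffs 0 1 0 0,
      fun h => one_ne_zero (congrArg (fun q : ℍ[ℝ] => q.imI) h), ?_, ?_⟩
    · ext <;> simp [hJ, hK]
    · ext <;> simp [h3]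
      linarith
  · refine ⟨_, h0, ?_, ?_⟩
    · ext <;> simp [hJ, hK] <;> ring
    · ext <;> simp <;> nlinarith

/-- Representatives of the conjugacy classes of pairs of unit quaternions: the first entry lies in
the closed upper half of `ℝ + ℝ i`, and the second in the part of `ℝ + ℝ i + ℝ j` where the
coefficient of `j` is nonnegative, or in the closed upper half of `ℝ + ℝ i` if the first entry is
central. -/
structure IsNormalPair (p : SQ × SQ) : Prop where
  fst_imI : 0 ≤ (p.1 : ℍ[ℝ]).imI
  fst_imJ : (p.1 : ℍ[ℝ]).imJ = 0
  fst_imK : (p.1 : ℍ[ℝ]).imK = 0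
  snd_imJ : 0 ≤ (p.2 : ℍ[ℝ]).imJ
  snd_imK : (p.2 : ℍ[ℝ]).imK = 0
  snd_of_central : (p.1 : ℍ[ℝ]).imI = 0 → 0 ≤ (p.2 : ℍ[ℝ]).imI ∧ (p.2 : ℍ[ℝ]).imJ = 0

lemma IsNormalPair.eq_of_pairAngles_eq {p q : SQ × SQ} (hp : IsNormalPair p)
    (hq : IsNormalPair q) (h : pairAngles p = pairAngles q) : p = q := by
  rw [pairAngles_eq_iff] at h
  obtain ⟨h1, h2, h12⟩ := h
  obtain ⟨a, b⟩ := p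
  obtain ⟨c, d⟩ := q
  obtain ⟨pI, pJ, pK, pJ', pK', p0⟩ := hp
  obtain ⟨qI, qJ, qK, qJ', qK', q0⟩ := hq
  have ha := a.sq_sum
  have hb := b.sq_sum
  have hc := c.sq_sum
  have hd := d.sq_sum
  dsimp only at *
  simp only [Metric.unitSphere.coe_mul, Quaternion.re_mul, pJ, pK, qJ, qK, pK', qK', h1, h2]
    at ha hb hc hd h12
  have hI : (a : ℍ[ℝ]).imI = (c : ℍ[ℝ]).imI :=
    (sq_eq_sq₀ pI qI).1 (by linarith)
  suffices hbd : (b : ℍ[ℝ]).imI = (d : ℍ[ℝ]).imI ∧ (b : ℍ[ℝ]).imJ = (d : ℍ[ℝ]).imJ by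
    refine Prod.ext (Subtype.ext ?_) (Subtype.ext ?_)
    · exact Quaternion.ext_iff.2 ⟨h1, hI, pJ.trans qJ.symm, pK.trans qK.symm⟩
    · exact Quaternion.ext_iff.2 ⟨h2, hbd.1, hbd.2, pK'.trans qK'.symm⟩
  by_cases h0 : (a : ℍ[ℝ]).imI = 0
  · obtain ⟨pI', pJ0⟩ := p0 h0
    obtain ⟨qI', qJ0⟩ := q0 (hI ▸ h0)
    rw [pJ0] at hb
    rw [qJ0] at hd
    exact ⟨(sq_eq_sq₀ pI' qI').1 (by linarith), pJ0.trans qJ0.symm⟩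
  · have hbI : (b : ℍ[ℝ]).imI = (d : ℍ[ℝ]).imI := by
      apply mul_left_cancel₀ h0
      rw [hI] at h12 ⊢
      linarith
    rw [hbI] at hb
    exact ⟨hbI, (sq_eq_sq₀ pJ' qJ').1 (by linarith)⟩

lemma exists_isNormalPair (p : SQ × SQ) :
    ∃ q, IsNormalPair q ∧ Relation.EqvGen (ConjRel SQ) p q := by
  obtain ⟨a, b⟩ := p
  obtain ⟨u, r, hr, hu⟩ := exists_conj_complex a
  rcases hr.eq_or_lt with rfl | hr'
  · have hcentral (w : SQ) : w * (u * a * u⁻¹) * w⁻¹ = u * a * u⁻¹ := by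
      rw [mul_inv_eq_iff_eq_mul]
      apply Subtype.ext
      rw [Metric.unitSphere.coe_mul w, Metric.unitSphere.coe_mul _ w, hu]
      ext <;> simp <;> ring
    obtain ⟨w, s, hs, hw⟩ := exists_conj_complex (u * b * u⁻¹)
    refine ⟨(u * a * u⁻¹, w * (u * b * u⁻¹) * w⁻¹), ?_, ?_⟩
    · constructor <;> simp [hu, hw, hs]
    · refine .rel _ _ ⟨w * u, ?_, ?_⟩
      · rw [← hcentral w]
        group
      · group
  · obtain ⟨w, hwa, hwK, hwJ⟩ := exists_conj_snd (a := u * a * u⁻¹) (b := u * b * u⁻¹)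
      (by rw [hu]; rfl) (by rw [hu]; rfl)
    refine ⟨(u * a * u⁻¹, w * (u * b * u⁻¹) * w⁻¹), ?_, ?_⟩
    · exact ⟨by rw [hu]; exact hr, by rw [hu]; rfl, by rw [hu]; rfl, hwJ, hwK,
        fun h => absurd (by rwa [hu] at h) hr'.ne'⟩
    · refine .rel _ _ ⟨w * u, ?_, ?_⟩
      · rw [← hwa]
        group
      · group

lemma eqvGen_iff_pairAngles_eq (p q : SQ × SQ) :
    Relation.EqvGen (ConjRel SQ) p q ↔ pairAngles p = pairAngles q := by
  refine ⟨pairAngles_eq_of_eqvGen, fun h => ?_⟩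
  obtain ⟨p', hp', hpp'⟩ := exists_isNormalPair p
  obtain ⟨q', hq', hqq'⟩ := exists_isNormalPair q
  have h' : p' = q' := hp'.eq_of_pairAngles_eq hq' <| by
    rw [← pairAngles_eq_of_eqvGen hpp', h, pairAngles_eq_of_eqvGen hqq']
  exact hpp'.trans _ _ _ (h' ▸ hqq'.symm _ _)

/-- The map induced by `pairAngles` on conjugacy classes. -/
def repAngles : RepF2 SQ → Tet :=
  Quotient.lift (fun p => ⟨pairAngles p, pairAngles_mem_Tet p⟩)
    fun _ _ h => Subtype.ext (pairAngles_eq_of_eqvGen h)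

lemma continuous_repAngles : Continuous repAngles :=
  (continuous_pairAngles.subtype_mk _).quotient_lift _

lemma bijective_repAngles : Function.Bijective repAngles := by
  constructor
  · rintro ⟨p⟩ ⟨q⟩ h
    exact Quotient.sound ((eqvGen_iff_pairAngles_eq p q).2 (congrArg Subtype.val h))
  · rintro ⟨t, ht⟩
    obtain ⟨p, rfl⟩ := exists_pairAngles_eq ht
    exact ⟨Quotient.mk _ p, rfl⟩

/-- The character space `rep(F₂, SU(2))` is homeomorphic to the solid
tetrahedron `T`. -/
theorem repF2_SU2_homeomorph_tet : Nonempty (RepF2 SQ ≃ₜ ↥Tet) :=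
  ⟨Continuous.homeoOfEquivCompactToT2 (f := Equiv.ofBijective _ bijective_repAngles)
    continuous_repAngles⟩
end
end

section
/- There exists an action of the Klein four-group ℤ/2 × ℤ/2 by homeomorphisms on rep(F₂, SU(2)) whose orbit space is homeomorphic to rep(F₂, SO(3)), and this action has a point with nontrivial stabilizer (so the induced four-to-one quotient map is a branched covering, not a genuine covering). -/
noncomputable section

open Real

open scoped Quaternion

/-! ### Character spaces -/

lemma conjRel_equivalence (G : Type) [Group G] : Equivalence (ConjRel G) where
  refl p := ⟨1, by simp, by simp⟩
  symm := by
    rintro p q ⟨g, h₁, h₂⟩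
    exact ⟨g⁻¹, by rw [h₁]; group, by rw [h₂]; group⟩
  trans := by
    rintro p q r ⟨g, h₁, h₂⟩ ⟨h, h₃, h₄⟩
    exact ⟨h * g, by rw [h₃, h₁]; group, by rw [h₄, h₂]; group⟩

namespace RepF2

variable {G H : Type} [Group G] [TopologicalSpace G] [Group H] [TopologicalSpace H]

/-- The class of a pair in the character space. -/
def mk (p : G × G) : RepF2 G := Quotient.mk _ p

lemma mk_eq_mk {p q : G × G} : mk p = mk q ↔ ConjRel G p q :=
  Quotient.eq.trans (conjRel_equivalence G).eqvGen_iff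

lemma isQuotientMap_mk : Topology.IsQuotientMap (mk : G × G → RepF2 G) :=
  isQuotientMap_quotient_mk'

lemma surjective_mk : Function.Surjective (mk : G × G → RepF2 G) :=
  isQuotientMap_mk.surjective

/-- A map of pairs that preserves conjugacy descends to character spaces. -/
def map (f : G × G → H × H) (hf : ∀ p q, ConjRel G p q → ConjRel H (f p) (f q)) :
    RepF2 G → RepF2 H :=
  Quotient.lift (fun p => mk (f p)) fun p q h =>
    mk_eq_mk.2 (hf p q ((conjRel_equivalence G).eqvGen_iff.1 h))

lemma continuous_map (f : G × G → H × H) (hf) (hc : Continuous f) : Continuous (map f hf) :=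
  isQuotientMap_mk.continuous_iff.2 (isQuotientMap_mk.continuous.comp hc)

end RepF2

lemma ConjRel.map {G H : Type} [Group G] [Group H] (φ : G →* H) {p q : G × G}
    (h : ConjRel G p q) : ConjRel H (φ p.1, φ p.2) (φ q.1, φ q.2) := by
  obtain ⟨g, h₁, h₂⟩ := h
  exact ⟨φ g, by simp [h₁], by simp [h₂]⟩

/-! ### The double cover `S → SO(3)` -/

/-- The matrix of `v ↦ q v q̄` on imaginary quaternions, in the basis `i, j, k`. -/
def quaternionRotation (q : ℍ[ℝ]) : Matrix (Fin 3) (Fin 3) ℝ :=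
  !![q.re ^ 2 + q.imI ^ 2 - q.imJ ^ 2 - q.imK ^ 2, 2 * (q.imI * q.imJ - q.re * q.imK),
      2 * (q.imI * q.imK + q.re * q.imJ);
    2 * (q.imI * q.imJ + q.re * q.imK), q.re ^ 2 - q.imI ^ 2 + q.imJ ^ 2 - q.imK ^ 2,
      2 * (q.imJ * q.imK - q.re * q.imI);
    2 * (q.imI * q.imK - q.re * q.imJ), 2 * (q.imJ * q.imK + q.re * q.imI),
      q.re ^ 2 - q.imI ^ 2 - q.imJ ^ 2 + q.imK ^ 2]

lemma quaternionRotation_one : quaternionRotation 1 = 1 := by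
  ext i j
  fin_cases i <;> fin_cases j <;> simp [quaternionRotation]

lemma quaternionRotation_mul (p q : ℍ[ℝ]) :
    quaternionRotation (p * q) = quaternionRotation p * quaternionRotation q := by
  ext i j
  fin_cases i <;> fin_cases j <;>
    simp [quaternionRotation, Matrix.mul_apply, Fin.sum_univ_three] <;> ring

lemma quaternionRotation_transpose_mul_self (q : ℍ[ℝ]) :
    (quaternionRotation q).transpose * quaternionRotation q = (Quaternion.normSq q ^ 2) • 1 := by
  ext i j
  fin_cases i <;> fin_cases j <;>
    simp [quaternionRotation, Matrix.mul_apply, Fin.sum_univ_three, Quaternion.normSq_def'] <;> ring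

lemma det_quaternionRotation (q : ℍ[ℝ]) :
    (quaternionRotation q).det = Quaternion.normSq q ^ 3 := by
  simp [quaternionRotation, Matrix.det_fin_three, Quaternion.normSq_def']
  ring

lemma continuous_quaternionRotation : Continuous quaternionRotation := by
  have := Quaternion.continuous_re
  have := Quaternion.continuous_imI
  have := Quaternion.continuous_imJ
  have := Quaternion.continuous_imK
  refine continuous_matrix fun i j => ?_
  fin_cases i <;> fin_cases j <;> simp [quaternionRotation] <;> fun_prop

lemma SQ.normSq_eq_one (q : SQ) : Quaternion.normSq (q : ℍ[ℝ]) = 1 := by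
  rw [Quaternion.normSq_eq_norm_mul_self, norm_eq_of_mem_sphere q, one_mul]

/-- The double cover `S → SO(3)`. -/
def spinCover : SQ →* SO3 where
  toFun q := ⟨⟨quaternionRotation q, (Matrix.mem_orthogonalGroup_iff' _ _).2 (by
      rw [quaternionRotation_transpose_mul_self, SQ.normSq_eq_one, one_pow, one_smul])⟩, by
    rw [SO3Subgroup, MonoidHom.mem_ker]
    simp [det_quaternionRotation, SQ.normSq_eq_one]⟩
  map_one' := Subtype.ext (Subtype.ext quaternionRotation_one)
  map_mul' p q := Subtype.ext (Subtype.ext (quaternionRotation_mul p q))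

lemma coe_spinCover (q : SQ) : ((spinCover q).1 : Matrix (Fin 3) (Fin 3) ℝ) =
    quaternionRotation q := rfl

lemma SO3.coe_injective : Function.Injective fun R : SO3 => (R.1 : Matrix (Fin 3) (Fin 3) ℝ) :=
  Subtype.val_injective.comp Subtype.val_injective

lemma continuous_spinCover : Continuous spinCover :=
  ((continuous_quaternionRotation.comp continuous_subtype_val).subtype_mk _).subtype_mk _

lemma spinCover_eq_one {q : SQ} : spinCover q = 1 ↔ q = 1 ∨ q = -1 := by
  constructor
  · intro h
    have hM : quaternionRotation q = 1 := congrArg (fun R : SO3 => R.1.1) h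
    have hn := SQ.normSq_eq_one q
    rw [Quaternion.normSq_def'] at hn
    have h₀ := congrFun (congrFun hM 0) 0
    have h₁ := congrFun (congrFun hM 1) 1
    simp [quaternionRotation] at h₀ h₁
    have hi : (q : ℍ[ℝ]).imI = 0 := by nlinarith
    have hj : (q : ℍ[ℝ]).imJ = 0 := by nlinarith
    have hk : (q : ℍ[ℝ]).imK = 0 := by nlinarith
    have hr : (q : ℍ[ℝ]).re = 1 ∨ (q : ℍ[ℝ]).re = -1 := by
      rw [← mul_self_eq_one_iff, ← sq]
      simpa [hi, hj, hk] using hn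
    refine hr.imp (fun hr => ?_) fun hr => ?_ <;>
      exact Subtype.ext (by ext <;> simp [hr, hi, hj, hk])
  · rintro (rfl | rfl)
    · exact map_one _
    · apply SO3.coe_injective
      simp only [coe_spinCover]
      ext i j
      fin_cases i <;> fin_cases j <;> simp [quaternionRotation]

lemma SO3.transpose_mul_self (R : SO3) : R.1.1.transpose * R.1.1 = 1 :=
  (Matrix.mem_orthogonalGroup_iff' _ _).1 R.1.2

lemma SO3.det_eq_one (R : SO3) : R.1.1.det = 1 := R.2

lemma SO3.adjugate_eq_transpose (R : SO3) : R.1.1.adjugate = R.1.1.transpose := by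
  have h := congrArg (R.1.1.transpose * ·) (Matrix.mul_adjugate R.1.1)
  simpa [← mul_assoc, SO3.transpose_mul_self, SO3.det_eq_one] using h

/-- The `j`-th column of a matrix, as an imaginary quaternion. -/
def columnQuaternion (R : Matrix (Fin 3) (Fin 3) ℝ) (j : Fin 3) : ℍ[ℝ] :=
  ⟨0, R 0 j, R 1 j, R 2 j⟩

section

variable (R : Matrix (Fin 3) (Fin 3) ℝ) (j : Fin 3)

@[simp] lemma columnQuaternion_re : (columnQuaternion R j).re = 0 := rfl

@[simp] lemma columnQuaternion_imI : (columnQuaternion R j).imI = R 0 j := rfl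

@[simp] lemma columnQuaternion_imJ : (columnQuaternion R j).imJ = R 1 j := rfl

@[simp] lemma columnQuaternion_imK : (columnQuaternion R j).imK = R 2 j := rfl

end

/-- If `q` is a unit quaternion conjugating `i, j, k` to the columns of `R`, then `R` is the
rotation of `q`. -/
lemma quaternionRotation_eq_of_column_mul {R : Matrix (Fin 3) (Fin 3) ℝ} {q : ℍ[ℝ]}
    (hq : Quaternion.normSq q = 1) (h : ∀ j, columnQuaternion R j * q = q * columnQuaternion 1 j) :
    quaternionRotation q = R := by
  have h' (j) : columnQuaternion R j = q * columnQuaternion 1 j * star q := by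
    rw [← h, mul_assoc, Quaternion.self_mul_star, hq, Quaternion.coe_one, mul_one]
  have h₀ := h' 0
  have h₁ := h' 1
  have h₂ := h' 2
  simp [Quaternion.ext_iff] at h₀ h₁ h₂
  ext i j
  fin_cases i <;> fin_cases j <;> simp [quaternionRotation, h₀, h₁, h₂] <;> ring

/-- The average of `p` under the two-sided action `v ↦ R(g) v g⁻¹` of the quaternion group. -/
def intertwiner (R : Matrix (Fin 3) (Fin 3) ℝ) (p : ℍ[ℝ]) : ℍ[ℝ] :=
  p - ∑ j, columnQuaternion R j * p * columnQuaternion 1 j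

lemma SO3.columnQuaternion_mul (R : SO3) :
    columnQuaternion R.1 0 * columnQuaternion R.1 0 = -1 ∧
    columnQuaternion R.1 1 * columnQuaternion R.1 1 = -1 ∧
    columnQuaternion R.1 2 * columnQuaternion R.1 2 = -1 ∧
    columnQuaternion R.1 0 * columnQuaternion R.1 1 = columnQuaternion R.1 2 ∧
    columnQuaternion R.1 1 * columnQuaternion R.1 2 = columnQuaternion R.1 0 ∧
    columnQuaternion R.1 2 * columnQuaternion R.1 0 = columnQuaternion R.1 1 := by
  have ho (i j) := congrFun (congrFun R.transpose_mul_self i) j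
  have ha (i j) := congrFun (congrFun R.adjugate_eq_transpose i) j
  simp only [Matrix.adjugate_fin_three, Matrix.mul_apply, Fin.sum_univ_three] at ho ha
  simp [Fin.forall_fin_succ] at ho ha
  refine ⟨?_, ?_, ?_, ?_, ?_, ?_⟩ <;> ext <;> simp <;> grind

/-- Averaging over a quaternion group intertwines left and right multiplication. -/
lemma mul_quaternionic_average {A : Type*} [Ring A] {u v w i j k : A} (p : A)
    (hu : u * u = -1) (huv : u * v = w) (hi : i * i = -1) (hj : j * j = -1) (hjk : j * k = i)
    (hki : k * i = j) :
    u * (p - (u * p * i + v * p * j + w * p * k)) =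
      (p - (u * p * i + v * p * j + w * p * k)) * i := by
  have huw : u * w = -v := by rw [← huv, ← mul_assoc, hu, neg_one_mul]
  have hji : j * i = -k := by rw [← hjk, ← mul_assoc, hj, neg_one_mul]
  simp only [mul_sub, mul_add, ← mul_assoc, hu, huv, huw]
  simp only [sub_mul, add_mul, mul_assoc, hi, hji, hki]
  noncomm_ring

lemma SO3.columnQuaternion_mul_intertwiner (R : SO3) (p : ℍ[ℝ]) (j : Fin 3) :
    columnQuaternion R.1 j * intertwiner R.1 p = intertwiner R.1 p * columnQuaternion 1 j := by
  obtain ⟨huu, hvv, hww, huv, hvw, hwu⟩ := R.columnQuaternion_mul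
  obtain ⟨hii, hjj, hkk, hij, hjk, hki⟩ := (1 : SO3).columnQuaternion_mul
  rw [intertwiner, Fin.sum_univ_three]
  fin_cases j
  · exact mul_quaternionic_average p huu huv hii hjj hjk hki
  · rw [add_assoc, add_comm (columnQuaternion R.1 0 * _ * _)]
    exact mul_quaternionic_average p hvv hvw hjj hkk hki hij
  · rw [add_comm, ← add_assoc]
    exact mul_quaternionic_average p hww hwu hkk hii hij hjk

lemma exists_intertwiner_ne_zero (R : Matrix (Fin 3) (Fin 3) ℝ) : ∃ p, intertwiner R p ≠ 0 := by
  by_contra! h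
  have h₀ := congrArg (·.re) (h 1)
  have h₁ := congrArg (·.imI) (h (columnQuaternion 1 0))
  have h₂ := congrArg (·.imJ) (h (columnQuaternion 1 1))
  have h₃ := congrArg (·.imK) (h (columnQuaternion 1 2))
  simp [intertwiner, Fin.sum_univ_three] at h₀ h₁ h₂ h₃
  linarith

lemma surjective_spinCover : Function.Surjective spinCover := by
  intro R
  obtain ⟨p, hp⟩ := exists_intertwiner_ne_zero R.1
  set q := intertwiner R.1 p with hq
  have hn : ‖(‖q‖⁻¹ • q)‖ = 1 := by
    rw [norm_smul, norm_inv, norm_norm, inv_mul_cancel₀ (norm_ne_zero_iff.2 hp)]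
  refine ⟨⟨‖q‖⁻¹ • q, by simpa using hn⟩, SO3.coe_injective ?_⟩
  refine quaternionRotation_eq_of_column_mul (SQ.normSq_eq_one _) fun j => ?_
  simp only [mul_smul_comm, smul_mul_assoc, hq, R.columnQuaternion_mul_intertwiner]

/-! ### The Klein four-group action -/

section

/-- A shortcut: the default instance search times out. -/
local instance : Mul SQ := Metric.unitSphere.instGroup.toMul

/-- The sign character `ℤ/2 → {±1}`, valued in the unit quaternions. -/
def SQ.sign (e : ZMod 2) : SQ := if e = 0 then 1 else -1

lemma SQ.sign_eq (e : ZMod 2) : SQ.sign e = 1 ∨ SQ.sign e = -1 := by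
  unfold SQ.sign; split_ifs <;> simp

lemma SQ.sign_zero : SQ.sign 0 = 1 := if_pos rfl

lemma SQ.sign_one : SQ.sign 1 = -1 := if_neg one_ne_zero

lemma SQ.sign_add (e f : ZMod 2) : SQ.sign (e + f) = SQ.sign e * SQ.sign f := by
  have h : (1 : ZMod 2) + 1 = 0 := rfl
  have h' (x : ZMod 2) : x = 0 ∨ x = 1 := by revert x; decide
  rcases h' e with rfl | rfl <;> rcases h' f with rfl | rfl <;>
    simp [SQ.sign_zero, SQ.sign_one, h]

lemma SQ.sign_conj (e : ZMod 2) (g a : SQ) :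
    SQ.sign e * (g * a * g⁻¹) = g * (SQ.sign e * a) * g⁻¹ := by
  rcases SQ.sign_eq e with h | h <;> simp [h]

lemma spinCover_eq_spinCover {a b : SQ} :
    spinCover a = spinCover b ↔ ∃ e, SQ.sign e * a = b := by
  rw [eq_comm, ← mul_inv_eq_one, ← map_inv, ← map_mul, spinCover_eq_one]
  simp only [mul_inv_eq_iff_eq_mul]
  constructor
  · rintro (h | h)
    · exact ⟨0, by rw [SQ.sign_zero, h]⟩
    · exact ⟨1, by rw [SQ.sign_one, h]⟩
  · rintro ⟨e, rfl⟩
    exact (SQ.sign_eq e).imp (by rintro h; rw [h]) (by rintro h; rw [h])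

/-- The action of the Klein four-group on `rep(F₂, S)` changing the signs of the two
generators. -/
def kleinAction (g : ZMod 2 × ZMod 2) : RepF2 SQ → RepF2 SQ :=
  RepF2.map (fun p => (SQ.sign g.1 * p.1, SQ.sign g.2 * p.2)) fun p q ⟨c, h₁, h₂⟩ =>
    ⟨c, by rw [h₁]; exact SQ.sign_conj _ _ _, by rw [h₂]; exact SQ.sign_conj _ _ _⟩

lemma kleinAction_mk (g : ZMod 2 × ZMod 2) (a b : SQ) :
    kleinAction g (RepF2.mk (a, b)) = RepF2.mk (SQ.sign g.1 * a, SQ.sign g.2 * b) := rfl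

lemma continuous_kleinAction (g : ZMod 2 × ZMod 2) : Continuous (kleinAction g) :=
  RepF2.continuous_map _ _ (by fun_prop)

lemma kleinAction_zero (x : RepF2 SQ) : kleinAction 0 x = x := by
  obtain ⟨⟨a, b⟩, rfl⟩ := RepF2.surjective_mk x
  simp [kleinAction_mk, SQ.sign_zero]

lemma kleinAction_add (g h : ZMod 2 × ZMod 2) (x : RepF2 SQ) :
    kleinAction (g + h) x = kleinAction g (kleinAction h x) := by
  obtain ⟨⟨a, b⟩, rfl⟩ := RepF2.surjective_mk x
  simp [kleinAction_mk, SQ.sign_add, mul_assoc]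

/-- The map of character spaces induced by the double cover. -/
def repSpinCover : RepF2 SQ → RepF2 SO3 :=
  RepF2.map (Prod.map spinCover spinCover) fun _ _ h => h.map spinCover

lemma isQuotientMap_repSpinCover : Topology.IsQuotientMap repSpinCover := by
  have : ProperSpace ℍ[ℝ] := FiniteDimensional.proper ℝ _
  have : CompactSpace SQ := inferInstance
  have hc : Continuous (Prod.map spinCover spinCover) :=
    continuous_spinCover.prodMap continuous_spinCover
  have hq : Topology.IsQuotientMap (Prod.map spinCover spinCover) :=
    .of_surjective_continuous (surjective_spinCover.prodMap surjective_spinCover) hc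
  exact .of_comp RepF2.isQuotientMap_mk.continuous (RepF2.continuous_map _ _ hc)
    (RepF2.isQuotientMap_mk.comp hq)

lemma repSpinCover_eq_iff {x y : RepF2 SQ} :
    repSpinCover x = repSpinCover y ↔ ∃ g, kleinAction g x = y := by
  obtain ⟨⟨a, b⟩, rfl⟩ := RepF2.surjective_mk x
  obtain ⟨⟨c, d⟩, rfl⟩ := RepF2.surjective_mk y
  constructor
  · intro h
    obtain ⟨R, h₁, h₂⟩ := RepF2.mk_eq_mk.1 h
    obtain ⟨q, rfl⟩ := surjective_spinCover R
    simp only [Prod.map_fst, Prod.map_snd, ← map_inv, ← map_mul] at h₁ h₂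
    obtain ⟨e, he⟩ := spinCover_eq_spinCover.1 h₁.symm
    obtain ⟨f, hf⟩ := spinCover_eq_spinCover.1 h₂.symm
    exact ⟨(e, f), RepF2.mk_eq_mk.2
      ⟨q, by simp [← he, SQ.sign_conj], by simp [← hf, SQ.sign_conj]⟩⟩
  · rintro ⟨g, hg⟩
    rw [← hg, kleinAction_mk]
    exact congrArg RepF2.mk (Prod.ext (spinCover_eq_spinCover.2 ⟨g.1, rfl⟩)
      (spinCover_eq_spinCover.2 ⟨g.2, rfl⟩))

/-- A quotient map whose fibres are the classes of the relation `r` identifies the quotient by `r`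
with its target. -/
lemma Topology.IsQuotientMap.nonempty_homeomorph_quotient {X Y : Type*} [TopologicalSpace X]
    [TopologicalSpace Y] {f : X → Y} (hf : Topology.IsQuotientMap f) {r : X → X → Prop}
    (hr : ∀ x y, r x y ↔ f x = f y) :
    Nonempty (Quotient (Relation.EqvGen.setoid r) ≃ₜ Y) := by
  have hs : Relation.EqvGen.setoid r = Setoid.ker f := by
    obtain rfl : r = (Setoid.ker f).r := by ext x y; exact hr x y
    ext x y
    exact (Setoid.ker f).iseqv.eqvGen_iff
  rw [hs]
  exact ⟨hf.homeomorph (f := ⟨f, hf.continuous⟩)⟩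

lemma kleinAction_fixed_point : ∃ (x : RepF2 SQ) (g : ZMod 2 × ZMod 2),
    g ≠ 0 ∧ kleinAction g x = x := by
  have mem (q : ℍ[ℝ]) (hq : Quaternion.normSq q = 1) : q ∈ Metric.sphere (0 : ℍ[ℝ]) 1 := by
    rw [mem_sphere_zero_iff_norm, ← sq_eq_sq₀ (norm_nonneg q) zero_le_one, sq,
      ← Quaternion.normSq_eq_norm_mul_self, hq, one_pow]
  let i : SQ := ⟨columnQuaternion 1 0, mem _ (by simp [Quaternion.normSq_def'])⟩
  let j : SQ := ⟨columnQuaternion 1 1, mem _ (by simp [Quaternion.normSq_def'])⟩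
  have hij : j * -i = i * j := Subtype.ext (by ext <;> simp [i, j])
  refine ⟨RepF2.mk (i, 1), (1, 0), by simp, ?_⟩
  rw [kleinAction_mk, RepF2.mk_eq_mk]
  refine ⟨j, ?_, by simp [SQ.sign_zero]⟩
  rw [eq_mul_inv_iff_mul_eq]
  simp [SQ.sign_one, hij]

end

/-- There is an action of the Klein four-group `ℤ/2 × ℤ/2` by
homeomorphisms on `rep(F₂, SU(2))` whose orbit space is homeomorphic to `rep(F₂, SO(3))`,
and the action has a point with nontrivial stabilizer. -/
theorem klein_action_branched_cover_repF2 :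
    ∃ act : ZMod 2 × ZMod 2 → RepF2 SQ → RepF2 SQ,
      (∀ g, Continuous (act g)) ∧
      (∀ x, act 0 x = x) ∧
      (∀ g h x, act (g + h) x = act g (act h x)) ∧
      Nonempty (Quotient (Relation.EqvGen.setoid fun x y => ∃ g, act g x = y) ≃ₜ RepF2 SO3) ∧
      ∃ (x : RepF2 SQ) (g : ZMod 2 × ZMod 2), g ≠ 0 ∧ act g x = x :=
  ⟨kleinAction, continuous_kleinAction, kleinAction_zero, kleinAction_add,
    isQuotientMap_repSpinCover.nonempty_homeomorph_quotient fun _ _ => repSpinCover_eq_iff.symm,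
    kleinAction_fixed_point⟩
end
end

section
/- Let a₁, b₁, a₂, b₂ be unit quaternions with [a₁,b₁]·[a₂,b₂] = −1, where [x,y] = x y x⁻¹ y⁻¹. If a unit quaternion q commutes with each of a₁, b₁, a₂, b₂, then q = 1 or q = −1. (Equivalently, every representation in rep₋(π₁Σ₁, SU(2)) has centralizer {±1}, so none is abelian.) -/
noncomputable section

open Real

open scoped Quaternion

/-- The centralizer of a non-real quaternion is commutative. -/
theorem Quaternion.commute_of_commute_of_im_ne_zero {q x y : ℍ[ℝ]} (hq : q.im ≠ 0)
    (hx : q * x = x * q) (hy : q * y = y * q) : x * y = y * x := by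
  have hx₁ := congrArg QuaternionAlgebra.imI hx
  have hx₂ := congrArg QuaternionAlgebra.imJ hx
  have hx₃ := congrArg QuaternionAlgebra.imK hx
  have hy₁ := congrArg QuaternionAlgebra.imI hy
  have hy₂ := congrArg QuaternionAlgebra.imJ hy
  have hy₃ := congrArg QuaternionAlgebra.imK hy
  simp only [Quaternion.imI_mul, Quaternion.imJ_mul, Quaternion.imK_mul]
    at hx₁ hx₂ hx₃ hy₁ hy₂ hy₃
  have hne : q.imI ≠ 0 ∨ q.imJ ≠ 0 ∨ q.imK ≠ 0 := by
    by_contra! h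
    exact hq (Quaternion.ext _ _ (Quaternion.re_im q) h.1 h.2.1 h.2.2)
  ext <;> simp only [Quaternion.re_mul, Quaternion.imI_mul, Quaternion.imJ_mul,
    Quaternion.imK_mul] <;> grind

/-- If unit quaternions `a₁, b₁, a₂, b₂` satisfy
`[a₁,b₁]·[a₂,b₂] = −1` and a unit quaternion `q` commutes with each of them, then
`q = 1` or `q = −1`. -/
theorem centralizer_of_minus_one_relation (a₁ b₁ a₂ b₂ q : ℍ[ℝ])
    (ha₁ : ‖a₁‖ = 1) (hb₁ : ‖b₁‖ = 1) (ha₂ : ‖a₂‖ = 1) (hb₂ : ‖b₂‖ = 1) (hq : ‖q‖ = 1)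
    (hrel : a₁ * b₁ * a₁⁻¹ * b₁⁻¹ * (a₂ * b₂ * a₂⁻¹ * b₂⁻¹) = -1)
    (hc₁ : q * a₁ = a₁ * q) (hc₂ : q * b₁ = b₁ * q)
    (hc₃ : q * a₂ = a₂ * q) (hc₄ : q * b₂ = b₂ * q) :
    q = 1 ∨ q = -1 := by
  by_cases him : q.im = 0
  · have hre : q = (q.re : ℍ[ℝ]) := by
      simpa [him] using (Quaternion.re_add_im q).symm
    rw [hre, Quaternion.norm_coe, Real.norm_eq_abs, abs_eq zero_le_one] at hq
    rcases hq with h | h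
    · left
      rw [hre, h, Quaternion.coe_one]
    · right
      rw [hre, h, Quaternion.coe_neg, Quaternion.coe_one]
  · have ne_zero {x : ℍ[ℝ]} (hx : ‖x‖ = 1) : x ≠ 0 := norm_ne_zero_iff.mp (by simp [hx])
    rw [Quaternion.commute_of_commute_of_im_ne_zero him hc₁ hc₂,
      Quaternion.commute_of_commute_of_im_ne_zero him hc₃ hc₄,
      mul_inv_cancel_right₀ (ne_zero ha₁), mul_inv_cancel₀ (ne_zero hb₁),
      mul_inv_cancel_right₀ (ne_zero ha₂), mul_inv_cancel₀ (ne_zero hb₂)] at hrel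
    have h := congrArg QuaternionAlgebra.re hrel
    norm_num at h
end
end

section
/- Let E be the group of eight linear isometries of ℝ⁴ given by the diagonal sign matrices diag(ε₁,ε₂,ε₃,ε₄) with each εᵢ ∈ {1,−1} and ε₁ε₂ε₃ε₄ = 1 (i.e., an even number of entries equal to −1), acting on the unit sphere S³ ⊂ ℝ⁴. Then the orbit space S³/E is homeomorphic to S³. -/
noncomputable section

open Real

/-- `ℝ⁴` as a Euclidean space. -/
abbrev V4 : Type := EuclideanSpace ℝ (Fin 4)

/-- The relation on the unit sphere `S³ ⊂ ℝ⁴` induced by the group `E` of diagonal sign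
matrices with an even number of `−1` entries. -/
def SignRel (x y : ↥(Metric.sphere (0 : V4) 1)) : Prop :=
  ∃ ε : Fin 4 → ℝ, (∀ i, ε i = 1 ∨ ε i = -1) ∧ (∏ i, ε i) = 1 ∧
    ∀ i, (y : V4) i = ε i * (x : V4) i

/-- The smaller of `|a|` and `|b|`, with the sign of `a * b`. -/
def signedMin (a b : ℝ) : ℝ := (|a + b| - |a - b|) / 2

lemma abs_signedMin (a b : ℝ) : |signedMin a b| = min |a| |b| := by
  unfold signedMin
  rcases abs_cases a with ⟨h1, _⟩ | ⟨h1, _⟩ <;> rcases abs_cases b with ⟨h2, _⟩ | ⟨h2, _⟩ <;>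
    rcases abs_cases (a + b) with ⟨h3, _⟩ | ⟨h3, _⟩ <;>
    rcases abs_cases (a - b) with ⟨h4, _⟩ | ⟨h4, _⟩ <;>
    rcases abs_cases ((|a + b| - |a - b|) / 2) with ⟨h5, _⟩ | ⟨h5, _⟩ <;>
    rcases min_cases |a| |b| with ⟨h6, _⟩ | ⟨h6, _⟩ <;> linarith

lemma signedMin_neg_left (a b : ℝ) : signedMin (-a) b = -signedMin a b := by
  unfold signedMin
  rw [show -a + b = -(a - b) by ring, show -a - b = -(a + b) by ring, abs_neg, abs_neg]
  ring

lemma signedMin_comm (a b : ℝ) : signedMin a b = signedMin b a := by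
  unfold signedMin
  rw [add_comm a b, abs_sub_comm a b]

lemma signedMin_neg_right (a b : ℝ) : signedMin a (-b) = -signedMin a b := by
  rw [signedMin_comm, signedMin_neg_left, signedMin_comm]

lemma signedMin_mul_mul {e d : ℝ} (he : e = 1 ∨ e = -1) (hd : d = 1 ∨ d = -1) (a b : ℝ) :
    signedMin (e * a) (d * b) = e * d * signedMin a b := by
  rcases he with rfl | rfl <;> rcases hd with rfl | rfl <;>
    simp [signedMin_neg_left, signedMin_neg_right]

lemma signedMin_smul {c : ℝ} (hc : 0 ≤ c) (a b : ℝ) :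
    signedMin (c * a) (c * b) = c * signedMin a b := by
  unfold signedMin
  rw [← mul_add, ← mul_sub, abs_mul, abs_mul, abs_of_nonneg hc]
  ring

lemma signedMin_of_nonneg {a b : ℝ} (ha : 0 ≤ a) (hb : 0 ≤ b) : signedMin a b = min a b := by
  unfold signedMin
  rw [abs_of_nonneg (add_nonneg ha hb)]
  rcases abs_cases (a - b) with ⟨h, _⟩ | ⟨h, _⟩ <;>
    rcases min_cases a b with ⟨h', _⟩ | ⟨h', _⟩ <;> linarith

/-- The smallest absolute value of a coordinate of `x`, with the sign of the product of the
coordinates. -/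
def signedMinCoord (x : V4) : ℝ := signedMin (signedMin (x 0) (x 1)) (signedMin (x 2) (x 3))

lemma abs_signedMinCoord (x : V4) :
    |signedMinCoord x| = min (min |x 0| |x 1|) (min |x 2| |x 3|) := by
  simp [signedMinCoord, abs_signedMin]

lemma signedMinCoord_of_signs {x y : V4} {ε : Fin 4 → ℝ} (hε : ∀ i, ε i = 1 ∨ ε i = -1)
    (h : ∀ i, y i = ε i * x i) : signedMinCoord y = (∏ i, ε i) * signedMinCoord x := by
  have key : ∀ {a b : ℝ}, (a = 1 ∨ a = -1) → (b = 1 ∨ b = -1) → (a * b = 1 ∨ a * b = -1) := by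
    rintro a b (rfl | rfl) (rfl | rfl) <;> simp
  simp only [signedMinCoord, h]
  rw [signedMin_mul_mul (hε 0) (hε 1), signedMin_mul_mul (hε 2) (hε 3),
    signedMin_mul_mul (key (hε 0) (hε 1)) (key (hε 2) (hε 3)), Fin.prod_univ_four]
  ring

/-- A positively homogeneous map `ℝ⁴ → ℝ⁴` whose fibres are the orbits of the even sign
changes. -/
def foldMap (x : V4) : V4 :=
  !₂[|x 0| - |x 3|, |x 1| - |x 3|, |x 2| - |x 3|, signedMinCoord x]

lemma continuous_foldMap : Continuous foldMap := by
  unfold foldMap signedMinCoord signedMin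
  refine (PiLp.continuous_toLp 2 _).comp (continuous_pi fun i => ?_)
  fin_cases i <;> simp <;> fun_prop

lemma foldMap_smul {c : ℝ} (hc : 0 ≤ c) (x : V4) : foldMap (c • x) = c • foldMap x := by
  ext i
  fin_cases i <;>
    simp [foldMap, signedMinCoord, signedMin_smul hc, abs_mul, abs_of_nonneg hc, mul_sub]

lemma foldMap_eq_of_signs {x y : V4} {ε : Fin 4 → ℝ} (hε : ∀ i, ε i = 1 ∨ ε i = -1)
    (hp : ∏ i, ε i = 1) (h : ∀ i, y i = ε i * x i) : foldMap y = foldMap x := by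
  have habs : ∀ i, |y i| = |x i| := fun i => by
    rcases hε i with h' | h' <;> simp [h, h']
  simp [foldMap, habs, signedMinCoord_of_signs hε h, hp]

lemma abs_eq_of_foldMap_eq {x y : V4} (h : foldMap x = foldMap y) (i : Fin 4) :
    |y i| = |x i| := by
  have h0 : |x 0| - |x 3| = |y 0| - |y 3| := congrArg (fun v : V4 => v 0) h
  have h1 : |x 1| - |x 3| = |y 1| - |y 3| := congrArg (fun v : V4 => v 1) h
  have h2 : |x 2| - |x 3| = |y 2| - |y 3| := congrArg (fun v : V4 => v 2) h
  have hq : signedMinCoord x = signedMinCoord y := congrArg (fun v : V4 => v 3) h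
  have hm := congrArg abs hq
  rw [abs_signedMinCoord, abs_signedMinCoord] at hm
  obtain ⟨d, hd⟩ : ∃ d, ∀ j, |x j| = |y j| + d := by
    refine ⟨|x 3| - |y 3|, fun j => ?_⟩
    fin_cases j <;> simp <;> linarith
  rw [hd 0, hd 1, hd 2, hd 3, min_add_add_right, min_add_add_right, min_add_add_right] at hm
  linarith [hd i]

lemma exists_signs_of_foldMap_eq {x y : V4} (h : foldMap x = foldMap y) :
    ∃ ε : Fin 4 → ℝ, (∀ i, ε i = 1 ∨ ε i = -1) ∧ ∏ i, ε i = 1 ∧ ∀ i, y i = ε i * x i := by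
  have hex : ∀ i, ∃ e : ℝ, (e = 1 ∨ e = -1) ∧ y i = e * x i := by
    intro i
    rcases abs_eq_abs.mp (abs_eq_of_foldMap_eq h i) with h' | h'
    · exact ⟨1, Or.inl rfl, by simpa using h'⟩
    · exact ⟨-1, Or.inr rfl, by simpa using h'⟩
  choose ε hε hy using hex
  have hprod : ∏ i, ε i = 1 ∨ ∏ i, ε i = -1 := by
    rw [← sq_eq_one_iff, ← Finset.prod_pow]
    exact Finset.prod_eq_one fun i _ => sq_eq_one_iff.mpr (hε i)
  rcases hprod with hp | hp
  · exact ⟨ε, hε, hp, hy⟩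
  have hq : signedMinCoord x = signedMinCoord y := congrArg (fun v : V4 => v 3) h
  rw [signedMinCoord_of_signs hε hy, hp] at hq
  have hx : ∃ j, x j = 0 := by
    have h0 := abs_signedMinCoord x
    rw [show signedMinCoord x = 0 by linarith, abs_zero] at h0
    by_contra! hne
    have := fun j => abs_pos.mpr (hne j)
    exact (lt_min (lt_min (this 0) (this 1)) (lt_min (this 2) (this 3))).ne h0
  obtain ⟨j, hj⟩ := hx
  refine ⟨Function.update ε j (-ε j), fun i => ?_, ?_, fun i => ?_⟩
  · rcases eq_or_ne i j with rfl | hij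
    · rcases hε i with h' | h' <;> simp [h']
    · simpa [hij] using hε i
  · rw [Finset.prod_update_of_mem (Finset.mem_univ j), neg_mul, ← Finset.erase_eq,
      Finset.mul_prod_erase _ _ (Finset.mem_univ j), hp, neg_neg]
  · rcases eq_or_ne i j with rfl | hij
    · simp [hy, hj]
    · simpa [hij] using hy i

lemma norm_eq_of_foldMap_eq {x y : V4} (h : foldMap x = foldMap y) : ‖y‖ = ‖x‖ := by
  simp [EuclideanSpace.norm_eq, -norm_eq_abs, Real.norm_eq_abs, abs_eq_of_foldMap_eq h]

lemma foldMap_zero : foldMap 0 = 0 := by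
  simpa using foldMap_smul le_rfl (0 : V4)

lemma foldMap_ne_zero {x : V4} (hx : x ≠ 0) : foldMap x ≠ 0 := fun h =>
  hx (norm_eq_zero.mp (by simpa using (norm_eq_of_foldMap_eq (h.trans foldMap_zero.symm)).symm))

lemma foldMap_surjective : Function.Surjective foldMap := by
  intro v
  set μ := min (min (v 0) (v 1)) (min (v 2) 0) with hμ
  set q := v 3
  have hq : 0 ≤ |q| := abs_nonneg q
  have h0 : 0 ≤ v 0 + (|q| - μ) := by
    linarith [(min_le_left _ _ : μ ≤ _), min_le_left (v 0) (v 1)]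
  have h1 : 0 ≤ v 1 + (|q| - μ) := by
    linarith [(min_le_left _ _ : μ ≤ _), min_le_right (v 0) (v 1)]
  have h2 : 0 ≤ v 2 + (|q| - μ) := by
    linarith [(min_le_right _ _ : μ ≤ _), min_le_left (v 2) 0]
  have h3 : 0 ≤ 0 + (|q| - μ) := by
    linarith [(min_le_right _ _ : μ ≤ _), min_le_right (v 2) 0]
  have hmin : signedMin (signedMin (v 0 + (|q| - μ)) (v 1 + (|q| - μ)))
      (signedMin (v 2 + (|q| - μ)) (0 + (|q| - μ))) = |q| := by
    rw [signedMin_of_nonneg h0 h1, signedMin_of_nonneg h2 h3,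
      signedMin_of_nonneg (le_min h0 h1) (le_min h2 h3), min_add_add_right, min_add_add_right,
      min_add_add_right, ← hμ]
    ring
  obtain ⟨e, he, heq⟩ : ∃ e : ℝ, (e = 1 ∨ e = -1) ∧ e * |q| = q := by
    rcases abs_choice q with h | h
    · exact ⟨1, Or.inl rfl, by simp [h]⟩
    · exact ⟨-1, Or.inr rfl, by simp [h]⟩
  have hcoord : signedMin (signedMin (e * (v 0 + (|q| - μ))) (v 1 + (|q| - μ)))
      (signedMin (v 2 + (|q| - μ)) (0 + (|q| - μ))) = q := by
    rcases he with rfl | rfl <;>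
      simpa only [one_mul, neg_one_mul, signedMin_neg_left, hmin] using heq
  have habs : |e * (v 0 + (|q| - μ))| = v 0 + (|q| - μ) := by
    rcases he with rfl | rfl <;> simp only [one_mul, neg_one_mul, abs_neg, abs_of_nonneg h0]
  refine ⟨!₂[e * (v 0 + (|q| - μ)), v 1 + (|q| - μ), v 2 + (|q| - μ), 0 + (|q| - μ)], ?_⟩
  ext i
  fin_cases i
  · change |e * (v 0 + (|q| - μ))| - |0 + (|q| - μ)| = v 0
    rw [habs, abs_of_nonneg h3]
    ring
  · change |v 1 + (|q| - μ)| - |0 + (|q| - μ)| = v 1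
    rw [abs_of_nonneg h1, abs_of_nonneg h3]
    ring
  · change |v 2 + (|q| - μ)| - |0 + (|q| - μ)| = v 2
    rw [abs_of_nonneg h2, abs_of_nonneg h3]
    ring
  · exact hcoord

lemma foldMap_coe_ne_zero (x : Metric.sphere (0 : V4) 1) : foldMap x ≠ 0 :=
  foldMap_ne_zero (ne_zero_of_mem_unit_sphere x)

/-- The map of the unit sphere to itself obtained by normalizing `foldMap`. -/
def sphereFold (x : Metric.sphere (0 : V4) 1) : Metric.sphere (0 : V4) 1 :=
  ⟨‖foldMap x‖⁻¹ • foldMap x, by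
    simp [norm_smul, norm_ne_zero_iff.mpr (foldMap_coe_ne_zero x)]⟩

lemma continuous_sphereFold : Continuous sphereFold := by
  have hc : Continuous fun x : Metric.sphere (0 : V4) 1 => foldMap x :=
    continuous_foldMap.comp continuous_subtype_val
  exact ((hc.norm.inv₀ fun x => norm_ne_zero_iff.mpr (foldMap_coe_ne_zero x)).smul hc).subtype_mk _

lemma sphereFold_surjective : Function.Surjective sphereFold := by
  intro v
  obtain ⟨x, hx⟩ := foldMap_surjective v
  have hx0 : x ≠ 0 := by
    rintro rfl
    exact ne_zero_of_mem_unit_sphere v (hx.symm.trans foldMap_zero)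
  have hn : ‖x‖ ≠ 0 := norm_ne_zero_iff.mpr hx0
  refine ⟨⟨‖x‖⁻¹ • x, by simp [norm_smul, hn]⟩, Subtype.ext ?_⟩
  simp [sphereFold, foldMap_smul, hx, norm_smul, smul_smul, hn]

lemma sphereFold_eq_iff (x y : Metric.sphere (0 : V4) 1) :
    sphereFold x = sphereFold y ↔ SignRel x y := by
  constructor
  · intro h
    have h' : ‖foldMap x‖⁻¹ • foldMap x = ‖foldMap y‖⁻¹ • foldMap y := congrArg Subtype.val h
    rw [← foldMap_smul (by positivity), ← foldMap_smul (by positivity)] at h'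
    have hn := norm_eq_of_foldMap_eq h'
    simp only [norm_smul, norm_inv, norm_norm, norm_eq_of_mem_sphere, mul_one] at hn
    rw [hn, foldMap_smul (by positivity), foldMap_smul (by positivity)] at h'
    exact exists_signs_of_foldMap_eq (smul_right_injective _
      (inv_ne_zero (norm_ne_zero_iff.mpr (foldMap_coe_ne_zero x))) h')
  · rintro ⟨ε, hε, hp, h⟩
    exact Subtype.ext (by simp [sphereFold, foldMap_eq_of_signs hε hp h])

/-- The orbit space `S³/E` of the unit sphere in `ℝ⁴` under the group of
even diagonal sign matrices is homeomorphic to `S³`. -/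
theorem sphere_quotient_signs_homeomorph_sphere :
    Nonempty (Quotient (Relation.EqvGen.setoid SignRel) ≃ₜ ↥(Metric.sphere (0 : V4) 1)) := by
  have hlift : ∀ x y, Relation.EqvGen.setoid SignRel x y → sphereFold x = sphereFold y :=
    fun x y h => by
      induction h with
      | rel x y h => exact (sphereFold_eq_iff x y).mpr h
      | refl x => rfl
      | symm x y _ ih => exact ih.symm
      | trans x y z _ _ ih₁ ih₂ => exact ih₁.trans ih₂
  have hinj : Function.Injective (Quotient.lift sphereFold hlift) := by
    rintro ⟨x⟩ ⟨y⟩ h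
    exact Quotient.sound (Relation.EqvGen.rel x y ((sphereFold_eq_iff x y).mp h))
  have hsurj : Function.Surjective (Quotient.lift sphereFold hlift) := fun v => by
    obtain ⟨x, hx⟩ := sphereFold_surjective v
    exact ⟨Quotient.mk _ x, hx⟩
  have hcont : Continuous (Quotient.lift sphereFold hlift) := continuous_sphereFold.quotient_lift _
  exact ⟨hcont.homeoOfEquivCompactToT2 (f := Equiv.ofBijective _ ⟨hinj, hsurj⟩)⟩
end
end
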